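/- arXiv:2501.16506 — 4 statements merged into one kernel-verified Lean document; each statement's English description precedes it below -/
import Mathlib

section
/- Let A, B, C be nonnegative reals with A+B+C=1 and C>0, and let (X_n, Y_n) be the double-birth-death Markov chain started at (0,+). Set v = (A−B)²/C + (A+B). Then for every fixed t>0, the random variables X_{⌊Mt⌋}/√M converge in distribution, as M→∞ through the positive integers, to a centered Gaussian distribution with variance v·t. -/
open MeasureTheory ProbabilityTheory

/-- One-step transition probabilities of the double-birth-death Markov chain on
ℤ × Bool (`true` is the "+" row, `false` is the "−" row): from (i,+) it moves to
(i+1,+) w.p. A, to (i-1,+) w.p. B, to (i,−) w.p. C; from (i,−) it moves to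
(i-1,−) w.p. A, to (i+1,−) w.p. B, to (i,+) w.p. C. -/
def dbdStep (A B C : ℝ) : ℤ × Bool → ℤ × Bool → ℝ
  | (i, true), (j, true) => if j = i + 1 then A else if j = i - 1 then B else 0
  | (i, true), (j, false) => if j = i then C else 0
  | (i, false), (j, false) => if j = i - 1 then A else if j = i + 1 then B else 0
  | (i, false), (j, true) => if j = i then C else 0

/-- `(X, Y)` is (a realisation of) the double-birth-death Markov chain with
parameters A, B, C started at (0,+): the probability of any finite path equals
the indicator of starting at (0, +) times the product of the one-step
transition probabilities along the path. -/
def IsDBDChain {Ω : Type*} [MeasurableSpace Ω] (μ : Measure Ω) (A B C : ℝ)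
    (X : ℕ → Ω → ℤ) (Y : ℕ → Ω → Bool) : Prop :=
  (∀ n, Measurable (X n)) ∧ (∀ n, Measurable (Y n)) ∧
    ∀ (n : ℕ) (s : ℕ → ℤ × Bool),
      (μ {ω | ∀ k ≤ n, (X k ω, Y k ω) = s k}).toReal =
        (if s 0 = ((0 : ℤ), true) then (1 : ℝ) else 0) *
          ∏ k ∈ Finset.range n, dbdStep A B C (s k) (s (k + 1))

/-- A jump by `e` in the direction of the row: `+e` in the row `true`, `-e` in the row `false`. -/
def dbdShift (e : ℤ) (z : ℤ × Bool) : ℤ × Bool := (if z.2 then z.1 + e else z.1 - e, z.2)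

/-- The move to the other row. -/
def dbdFlip (z : ℤ × Bool) : ℤ × Bool := (z.1, !z.2)

/-- The Fourier character `z ↦ exp (i θ x)` of the position. -/
noncomputable def dbdChar (θ : ℝ) (z : ℤ × Bool) : ℂ := Complex.exp ((θ * z.1 : ℝ) * Complex.I)

/-- The Fourier character of the position, signed by the row. -/
noncomputable def dbdSignedChar (θ : ℝ) (z : ℤ × Bool) : ℂ :=
  if z.2 then dbdChar θ z else -dbdChar θ z

lemma dbdStep_eq (A B C : ℝ) (z w : ℤ × Bool) :
    dbdStep A B C z w = A * (if dbdShift 1 z = w then 1 else 0)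
      + B * (if dbdShift (-1) z = w then 1 else 0) + C * (if dbdFlip z = w then 1 else 0) := by
  obtain ⟨i, a⟩ := z
  obtain ⟨j, b⟩ := w
  cases a <;> cases b <;> simp [dbdStep, dbdShift, dbdFlip, Prod.ext_iff] <;> grind

lemma norm_dbdChar (θ : ℝ) (z : ℤ × Bool) : ‖dbdChar θ z‖ = 1 :=
  Complex.norm_exp_ofReal_mul_I _

lemma norm_dbdSignedChar (θ : ℝ) (z : ℤ × Bool) : ‖dbdSignedChar θ z‖ = 1 := by
  unfold dbdSignedChar
  split_ifs <;> simp [norm_dbdChar]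

lemma dbdChar_add (θ : ℝ) (i j : ℤ) (b c : Bool) :
    dbdChar θ (i + j, b) =
      dbdChar θ (i, c) * (Real.cos (θ * j) + Real.sin (θ * j) * Complex.I) := by
  have h : ((θ * (i + j : ℤ) : ℝ) : ℂ) * Complex.I
      = (θ * i : ℝ) * Complex.I + (θ * j : ℝ) * Complex.I := by
    push_cast
    ring
  rw [dbdChar, dbdChar, h, Complex.exp_add, Complex.exp_mul_I (θ * j : ℝ), Complex.ofReal_cos,
    Complex.ofReal_sin]

lemma dbdChar_dbdShift (θ : ℝ) (e : ℤ) (z : ℤ × Bool) :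
    dbdChar θ (dbdShift e z) =
      Real.cos (θ * e) * dbdChar θ z + Real.sin (θ * e) * Complex.I * dbdSignedChar θ z := by
  obtain ⟨i, b⟩ := z
  cases b
  · have := dbdChar_add θ i (-e) false false
    simp only [Int.cast_neg, mul_neg, Real.cos_neg, Real.sin_neg] at this
    simp only [dbdShift, dbdSignedChar, Bool.false_eq_true, if_false, sub_eq_add_neg, this]
    push_cast
    ring
  · simp only [dbdShift, dbdSignedChar, if_true, dbdChar_add θ i e true true]
    ring

lemma dbdSignedChar_dbdShift (θ : ℝ) (e : ℤ) (z : ℤ × Bool) :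
    dbdSignedChar θ (dbdShift e z) =
      Real.cos (θ * e) * dbdSignedChar θ z + Real.sin (θ * e) * Complex.I * dbdChar θ z := by
  have h := dbdChar_dbdShift θ e z
  obtain ⟨i, b⟩ := z
  cases b
  · simp only [dbdShift, dbdSignedChar, Bool.false_eq_true, if_false] at h ⊢
    rw [h]
    ring
  · simpa [dbdShift, dbdSignedChar] using h

lemma dbdChar_dbdFlip (θ : ℝ) (z : ℤ × Bool) : dbdChar θ (dbdFlip z) = dbdChar θ z := rfl

lemma dbdSignedChar_dbdFlip (θ : ℝ) (z : ℤ × Bool) :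
    dbdSignedChar θ (dbdFlip z) = -dbdSignedChar θ z := by
  obtain ⟨i, b⟩ := z
  cases b <;> simp [dbdSignedChar, dbdFlip, dbdChar]

section Chain

variable {Ω : Type*} [MeasurableSpace Ω] {μ : Measure Ω} {A B C : ℝ}
  {X : ℕ → Ω → ℤ} {Y : ℕ → Ω → Bool}

lemma IsDBDChain.measurable_prodMk (h : IsDBDChain μ A B C X Y) (n : ℕ) :
    Measurable fun ω => (X n ω, Y n ω) :=
  (h.1 n).prodMk (h.2.1 n)

/-- The **Markov property** along a fixed history. -/
lemma IsDBDChain.measureReal_path_inter (h : IsDBDChain μ A B C X Y) (n : ℕ)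
    (s : ℕ → ℤ × Bool) (w : ℤ × Bool) :
    μ.real {ω | (∀ k ≤ n, (X k ω, Y k ω) = s k) ∧ (X (n + 1) ω, Y (n + 1) ω) = w} =
      μ.real {ω | ∀ k ≤ n, (X k ω, Y k ω) = s k} * dbdStep A B C (s n) w := by
  let s' : ℕ → ℤ × Bool := fun k => if k ≤ n then s k else w
  have hs : ∀ k ≤ n, s' k = s k := fun k hk => if_pos hk
  have hw : s' (n + 1) = w := if_neg (by omega)
  have hset : {ω | (∀ k ≤ n, (X k ω, Y k ω) = s k) ∧ (X (n + 1) ω, Y (n + 1) ω) = w} =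
      {ω | ∀ k ≤ n + 1, (X k ω, Y k ω) = s' k} := by
    ext ω
    simp only [Set.mem_ofPred_eq]
    constructor
    · rintro ⟨h1, h2⟩ k hk
      rcases Nat.le_succ_iff.1 hk with hk | rfl
      · rw [hs k hk, h1 k hk]
      · rw [hw, h2]
    · exact fun h1 => ⟨fun k hk => by rw [← hs k hk, h1 k (by omega)],
        by rw [← hw, h1 _ le_rfl]⟩
  rw [hset, Measure.real, Measure.real, h.2.2, h.2.2, Finset.prod_range_succ, hs 0 (Nat.zero_le n),
    hs n le_rfl, hw, ← mul_assoc]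
  congr 2
  exact Finset.prod_congr rfl fun k hk => by
    have := Finset.mem_range.1 hk
    rw [hs k this.le, hs (k + 1) this]

variable [IsProbabilityMeasure μ]

lemma IsDBDChain.map_history_succ (h : IsDBDChain μ A B C X Y) (hA : 0 ≤ A) (hB : 0 ≤ B)
    (hC : 0 ≤ C) (n : ℕ) :
    μ.map (fun ω => ((fun k : Fin (n + 1) => (X k ω, Y k ω)), (X (n + 1) ω, Y (n + 1) ω))) =
      A.toNNReal • μ.map (fun ω => ((fun k : Fin (n + 1) => (X k ω, Y k ω)),
          dbdShift 1 (X n ω, Y n ω)))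
      + B.toNNReal • μ.map (fun ω => ((fun k : Fin (n + 1) => (X k ω, Y k ω)),
          dbdShift (-1) (X n ω, Y n ω)))
      + C.toNNReal • μ.map (fun ω => ((fun k : Fin (n + 1) => (X k ω, Y k ω)),
          dbdFlip (X n ω, Y n ω))) := by
  have hH : Measurable fun ω => (fun k : Fin (n + 1) => (X k ω, Y k ω)) :=
    measurable_pi_lambda _ fun k => h.measurable_prodMk k
  have hm (g : ℤ × Bool → ℤ × Bool) : Measurable fun ω => g (X n ω, Y n ω) :=
    (measurable_of_countable g).comp (h.measurable_prodMk n)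
  refine Measure.ext_of_singleton fun p => ?_
  obtain ⟨s, w⟩ := p
  let s' : ℕ → ℤ × Bool := fun k => if hk : k < n + 1 then s ⟨k, hk⟩ else w
  have hs' (ω : Ω) : (fun k : Fin (n + 1) => (X k ω, Y k ω)) = s ↔
      ∀ k ≤ n, (X k ω, Y k ω) = s' k := by
    simp only [funext_iff, Fin.forall_iff, s', ← Nat.lt_succ_iff]
    exact forall₂_congr fun k hk => by rw [dif_pos hk]
  have key (g : ℤ × Bool → ℤ × Bool) :
      (μ.map (fun ω => ((fun k : Fin (n + 1) => (X k ω, Y k ω)), g (X n ω, Y n ω)))).real {(s, w)} =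
        μ.real {ω | ∀ k ≤ n, (X k ω, Y k ω) = s' k} * (if g (s' n) = w then 1 else 0) := by
    rw [map_measureReal_apply (hH.prodMk (hm g)) (measurableSet_singleton _)]
    split_ifs with hg
    · rw [mul_one]
      congr 1
      ext ω
      simp only [Set.mem_preimage, Set.mem_singleton_iff,
        Prod.mk.injEq (fun k : Fin (n + 1) => (X k ω, Y k ω)), Set.mem_ofPred_eq, hs']
      exact ⟨fun h => h.1, fun h => ⟨h, by rw [h n le_rfl, hg]⟩⟩
    · rw [mul_zero]
      convert measureReal_empty (μ := μ)
      ext ω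
      simp only [Set.mem_preimage, Set.mem_singleton_iff,
        Prod.mk.injEq (fun k : Fin (n + 1) => (X k ω, Y k ω)), hs', Set.mem_empty_iff_false,
        iff_false]
      exact fun h => hg (by rw [← h.1 n le_rfl, h.2])
  rw [← measureReal_eq_measureReal_iff,
    map_measureReal_apply (hH.prodMk (h.measurable_prodMk _)) (measurableSet_singleton _),
    measureReal_add_apply, measureReal_add_apply, measureReal_nnreal_smul_apply,
    measureReal_nnreal_smul_apply, measureReal_nnreal_smul_apply, key, key, key,
    Real.coe_toNNReal _ hA, Real.coe_toNNReal _ hB, Real.coe_toNNReal _ hC]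
  have hset : (fun ω => ((fun k : Fin (n + 1) => (X k ω, Y k ω)),
      (X (n + 1) ω, Y (n + 1) ω))) ⁻¹' {(s, w)} =
      {ω | (∀ k ≤ n, (X k ω, Y k ω) = s' k) ∧ (X (n + 1) ω, Y (n + 1) ω) = w} := by
    ext ω
    simp only [Set.mem_preimage, Set.mem_singleton_iff,
      Prod.mk.injEq (fun k : Fin (n + 1) => (X k ω, Y k ω)), hs', Set.mem_ofPred_eq]
  rw [hset, h.measureReal_path_inter, dbdStep_eq]
  ring

/-- The one-step evolution of expectations of bounded functions of the chain. -/
lemma IsDBDChain.integral_succ (h : IsDBDChain μ A B C X Y) (hA : 0 ≤ A) (hB : 0 ≤ B)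
    (hC : 0 ≤ C) (n : ℕ) (g : ℤ × Bool → ℂ) (hg : ∀ z, ‖g z‖ ≤ 1) :
    ∫ ω, g (X (n + 1) ω, Y (n + 1) ω) ∂μ =
      A * ∫ ω, g (dbdShift 1 (X n ω, Y n ω)) ∂μ + B * ∫ ω, g (dbdShift (-1) (X n ω, Y n ω)) ∂μ
        + C * ∫ ω, g (dbdFlip (X n ω, Y n ω)) ∂μ := by
  have hH : Measurable fun ω => (fun k : Fin (n + 1) => (X k ω, Y k ω)) :=
    measurable_pi_lambda _ fun k => h.measurable_prodMk k
  have hm (g : ℤ × Bool → ℤ × Bool) : Measurable fun ω => g (X n ω, Y n ω) :=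
    (measurable_of_countable g).comp (h.measurable_prodMk n)
  let G : (Fin (n + 1) → ℤ × Bool) × (ℤ × Bool) → ℂ := fun p => g p.2
  have hG : Measurable G := (measurable_of_countable g).comp measurable_snd
  have hint (ν : Measure ((Fin (n + 1) → ℤ × Bool) × (ℤ × Bool))) [IsFiniteMeasure ν] :
      Integrable G ν :=
    Integrable.of_bound hG.aestronglyMeasurable 1 (Filter.Eventually.of_forall fun p => hg p.2)
  have hmap {Z : Ω → ℤ × Bool} (hZ : Measurable Z) :
      ∫ p, G p ∂(μ.map fun ω => ((fun k : Fin (n + 1) => (X k ω, Y k ω)), Z ω)) =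
        ∫ ω, g (Z ω) ∂μ :=
    integral_map (hH.prodMk hZ).aemeasurable hG.aestronglyMeasurable
  rw [← hmap (h.measurable_prodMk (n + 1)), h.map_history_succ hA hB hC,
    integral_add_measure (hint _) (hint _), integral_add_measure (hint _) (hint _),
    integral_smul_nnreal_measure, integral_smul_nnreal_measure, integral_smul_nnreal_measure,
    hmap (hm _), hmap (hm _), hmap (hm _)]
  simp only [NNReal.smul_def, Real.coe_toNNReal _ hA, Real.coe_toNNReal _ hB,
    Real.coe_toNNReal _ hC, Complex.real_smul]

lemma IsDBDChain.integrable_comp (h : IsDBDChain μ A B C X Y) (n : ℕ) {g : ℤ × Bool → ℂ}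
    (hg : ∀ z, ‖g z‖ = 1) : Integrable (fun ω => g (X n ω, Y n ω)) μ :=
  Integrable.of_bound
    ((measurable_of_countable g).comp (h.measurable_prodMk n)).aestronglyMeasurable 1
    (Filter.Eventually.of_forall fun _ => (hg _).le)

lemma IsDBDChain.integral_dbdChar_succ (h : IsDBDChain μ A B C X Y) (hA : 0 ≤ A) (hB : 0 ≤ B)
    (hC : 0 ≤ C) (n : ℕ) (θ : ℝ) :
    ∫ ω, dbdChar θ (X (n + 1) ω, Y (n + 1) ω) ∂μ =
      ((A + B) * Real.cos θ + C : ℝ) * ∫ ω, dbdChar θ (X n ω, Y n ω) ∂μ +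
      ((A - B) * Real.sin θ : ℝ) * Complex.I * ∫ ω, dbdSignedChar θ (X n ω, Y n ω) ∂μ := by
  have h0 := h.integrable_comp n (norm_dbdChar θ)
  have h1 := h.integrable_comp n (norm_dbdSignedChar θ)
  rw [h.integral_succ hA hB hC n _ fun z => (norm_dbdChar θ z).le]
  simp only [dbdChar_dbdShift, dbdChar_dbdFlip]
  rw [integral_add (h0.const_mul _) (h1.const_mul _), integral_add (h0.const_mul _) (h1.const_mul _)]
  simp only [integral_const_mul, Int.cast_one, Int.cast_neg, mul_neg, mul_one, Real.cos_neg,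
    Real.sin_neg]
  push_cast
  ring

lemma IsDBDChain.integral_dbdSignedChar_succ (h : IsDBDChain μ A B C X Y) (hA : 0 ≤ A)
    (hB : 0 ≤ B) (hC : 0 ≤ C) (n : ℕ) (θ : ℝ) :
    ∫ ω, dbdSignedChar θ (X (n + 1) ω, Y (n + 1) ω) ∂μ =
      ((A + B) * Real.cos θ - C : ℝ) * ∫ ω, dbdSignedChar θ (X n ω, Y n ω) ∂μ +
      ((A - B) * Real.sin θ : ℝ) * Complex.I * ∫ ω, dbdChar θ (X n ω, Y n ω) ∂μ := by
  have h0 := h.integrable_comp n (norm_dbdChar θ)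
  have h1 := h.integrable_comp n (norm_dbdSignedChar θ)
  rw [h.integral_succ hA hB hC n _ fun z => (norm_dbdSignedChar θ z).le]
  simp only [dbdSignedChar_dbdShift, dbdSignedChar_dbdFlip]
  rw [integral_add (h1.const_mul _) (h0.const_mul _), integral_add (h1.const_mul _) (h0.const_mul _)]
  simp only [integral_const_mul, integral_neg, Int.cast_one, Int.cast_neg, mul_neg, mul_one,
    Real.cos_neg, Real.sin_neg]
  push_cast
  ring

lemma IsDBDChain.ae_zero (h : IsDBDChain μ A B C X Y) :
    ∀ᵐ ω ∂μ, (X 0 ω, Y 0 ω) = ((0 : ℤ), true) := by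
  have h0 := h.2.2 0 fun _ => (0, true)
  simp only [Nat.le_zero, forall_eq, if_true, Finset.range_zero, Finset.prod_empty,
    mul_one] at h0
  exact (mem_ae_iff_prob_eq_one (h.measurable_prodMk 0 (measurableSet_singleton _))).2
    ((ENNReal.toReal_eq_one_iff _).1 h0)

/-- The characteristic function of `X n` is, for a small frequency, close to the `n`-th power of an
approximate leading eigenvalue of the Fourier-transformed transition matrix. -/
lemma IsDBDChain.norm_integral_dbdChar_sub_pow_le (h : IsDBDChain μ A B C X Y) (hA : 0 ≤ A)
    (hB : 0 ≤ B) (hC : 0 < C) (n : ℕ) (θ δ l : ℝ) (hδ : 2 * C * δ = (A - B) * Real.sin θ)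
    (hl : l = (A + B) * Real.cos θ + C - 2 * C * δ ^ 2) (hl1 : |l| ≤ 1) :
    ‖∫ ω, dbdChar θ (X n ω, Y n ω) ∂μ - (l : ℂ) ^ n‖ ≤ 2 * |δ| + n * (2 * C * |δ| ^ 3) := by
  set S : ℕ → ℂ := fun n => ∫ ω, dbdChar θ (X n ω, Y n ω) ∂μ with hS
  set T : ℕ → ℂ := fun n => ∫ ω, dbdSignedChar θ (X n ω, Y n ω) ∂μ with hT
  have hSs (n) : S (n + 1) = ((A + B) * Real.cos θ + C : ℝ) * S n
      + (2 * C * δ : ℝ) * Complex.I * T n := by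
    rw [hδ]; exact h.integral_dbdChar_succ hA hB hC.le n θ
  have hTs (n) : T (n + 1) = ((A + B) * Real.cos θ - C : ℝ) * T n
      + (2 * C * δ : ℝ) * Complex.I * S n := by
    rw [hδ]; exact h.integral_dbdSignedChar_succ hA hB hC.le n θ
  have hS0 : S 0 = 1 := by
    have : (fun ω => dbdChar θ (X 0 ω, Y 0 ω)) =ᵐ[μ] fun _ => 1 := by
      filter_upwards [h.ae_zero] with ω hω
      rw [hω]
      simp [dbdChar]
    simp [hS, integral_congr_ae this]
  have hT0 : T 0 = 1 := by
    have : (fun ω => dbdSignedChar θ (X 0 ω, Y 0 ω)) =ᵐ[μ] fun _ => 1 := by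
      filter_upwards [h.ae_zero] with ω hω
      rw [hω]
      simp [dbdChar, dbdSignedChar]
    simp [hT, integral_congr_ae this]
  have hTn (n) : ‖T n‖ ≤ 1 := by
    simpa using norm_integral_le_of_norm_le_const (μ := μ)
      (Filter.Eventually.of_forall fun ω => (norm_dbdSignedChar θ (X n ω, Y n ω)).le)
  have hpow (n : ℕ) : ‖(l : ℂ) ^ n‖ ≤ 1 := by
    rw [norm_pow, Complex.norm_real]
    exact pow_le_one₀ (norm_nonneg _) hl1
  have hW (n : ℕ) : ‖S n + δ * Complex.I * T n - l ^ n * (1 + δ * Complex.I)‖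
      ≤ n * (2 * C * |δ| ^ 3) := by
    induction n with
    | zero => simp [hS0, hT0]
    | succ n ih =>
      have e : S (n + 1) + δ * Complex.I * T (n + 1) - l ^ (n + 1) * (1 + δ * Complex.I) =
          l * (S n + δ * Complex.I * T n - l ^ n * (1 + δ * Complex.I))
            + (2 * C * δ ^ 3 : ℝ) * Complex.I * T n := by
        rw [hSs, hTs, hl]
        push_cast
        linear_combination (2 * C * δ ^ 2 * S n : ℂ) * Complex.I_sq
      rw [e]
      refine (norm_add_le _ _).trans ?_
      rw [norm_mul, norm_mul, norm_mul, Complex.norm_real, Complex.norm_real, Complex.norm_I,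
        Real.norm_eq_abs, Real.norm_eq_abs, abs_mul, abs_pow, abs_of_pos (by positivity : 0 < 2 * C)]
      have h1 := mul_le_mul hl1 ih (norm_nonneg _) zero_le_one
      have h2 := mul_le_mul_of_nonneg_left (hTn n) (by positivity : 0 ≤ 2 * C * |δ| ^ 3)
      push_cast
      linarith
  have e : S n - (l : ℂ) ^ n = (S n + δ * Complex.I * T n - l ^ n * (1 + δ * Complex.I))
      + δ * Complex.I * (l ^ n - T n) := by ring
  rw [e]
  refine (norm_add_le _ _).trans ?_
  rw [norm_mul, norm_mul, Complex.norm_real, Complex.norm_I, Real.norm_eq_abs]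
  have h1 : ‖(l : ℂ) ^ n - T n‖ ≤ 2 := (norm_sub_le _ _).trans (by linarith [hpow n, hTn n])
  have h2 := mul_le_mul_of_nonneg_left h1 (abs_nonneg δ)
  linarith [hW n]

end Chain

open Filter Topology

lemma tendsto_sqrt_mul_sin_div_sqrt (y : ℝ) :
    Tendsto (fun M : ℕ => √(M : ℝ) * Real.sin (y / √(M : ℝ))) atTop (𝓝 y) := by
  have hs : Tendsto (fun M : ℕ => √(M : ℝ)) atTop atTop :=
    Real.tendsto_sqrt_atTop.comp tendsto_natCast_atTop_atTop
  have h : Tendsto (fun M : ℕ => y * Real.sinc (y / √(M : ℝ))) atTop (𝓝 (y * Real.sinc 0)) :=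
    ((Real.continuous_sinc.tendsto 0).comp (hs.const_div_atTop y)).const_mul y
  rw [Real.sinc_zero, mul_one] at h
  refine h.congr' ?_
  filter_upwards [eventually_gt_atTop 0] with M hM
  have hM' : √(M : ℝ) ≠ 0 := by positivity
  rcases eq_or_ne y 0 with rfl | hy
  · simp
  · rw [Real.sinc_of_ne_zero (div_ne_zero hy hM')]
    field_simp

lemma tendsto_nat_floor_natCast_mul_div {t : ℝ} (ht : 0 ≤ t) :
    Tendsto (fun M : ℕ => (⌊(M : ℝ) * t⌋₊ : ℝ) / M) atTop (𝓝 t) := by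
  simpa [Function.comp_def, mul_comm] using
    (tendsto_nat_floor_mul_div_atTop ht).comp (tendsto_natCast_atTop_atTop (R := ℝ))

lemma tendsto_one_add_pow_nat_floor {g : ℕ → ℝ} {c t : ℝ} (ht : 0 ≤ t)
    (hg : Tendsto (fun M : ℕ => M * g M) atTop (𝓝 c)) (hg0 : Tendsto g atTop (𝓝 0)) :
    Tendsto (fun M : ℕ => (1 + g M) ^ ⌊(M : ℝ) * t⌋₊) atTop (𝓝 (Real.exp (t * c))) := by
  have h := (Real.continuous_exp.tendsto _).comp
    ((tendsto_nat_floor_natCast_mul_div ht).mul (Real.tendsto_nat_mul_log_one_add_of_tendsto hg))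
  refine h.congr' ?_
  filter_upwards [hg0.eventually_const_lt (show (-1 : ℝ) < 0 by simp), eventually_gt_atTop 0]
    with M hM hM0
  have : (M : ℝ) ≠ 0 := by positivity
  rw [Function.comp_apply, ← mul_assoc, div_mul_cancel₀ _ this, Real.exp_nat_mul,
    Real.exp_log (by linarith)]

lemma IsDBDChain.tendsto_integral_dbdChar {A B C : ℝ} (hA : 0 ≤ A) (hB : 0 ≤ B) (hC : 0 < C)
    (hsum : A + B + C = 1) {Ω : Type*} [MeasurableSpace Ω] {μ : Measure Ω}
    [IsProbabilityMeasure μ] {X : ℕ → Ω → ℤ} {Y : ℕ → Ω → Bool} (h : IsDBDChain μ A B C X Y)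
    {t : ℝ} (ht : 0 ≤ t) (x : ℝ) :
    Tendsto (fun M : ℕ => ∫ ω, dbdChar (x / √(M : ℝ))
        (X ⌊(M : ℝ) * t⌋₊ ω, Y ⌊(M : ℝ) * t⌋₊ ω) ∂μ) atTop
      (𝓝 (Real.exp (t * (-((A - B) ^ 2 / C + (A + B)) * x ^ 2 / 2)) : ℝ)) := by
  set δ : ℕ → ℝ := fun M => (A - B) / (2 * C) * Real.sin (x / √(M : ℝ)) with hδ
  set g : ℕ → ℝ := fun M =>
    -(2 * (A + B) * Real.sin (x / 2 / √(M : ℝ)) ^ 2 + 2 * C * δ M ^ 2) with hg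
  have hs : Tendsto (fun M : ℕ => √(M : ℝ)) atTop atTop :=
    Real.tendsto_sqrt_atTop.comp tendsto_natCast_atTop_atTop
  have hsin (y : ℝ) : Tendsto (fun M : ℕ => Real.sin (y / √(M : ℝ))) atTop (𝓝 0) := by
    simpa [Function.comp_def] using (Real.continuous_sin.tendsto 0).comp (hs.const_div_atTop y)
  have hδ0 : Tendsto δ atTop (𝓝 0) := by simpa using (hsin x).const_mul ((A - B) / (2 * C))
  have hδ1 : Tendsto (fun M : ℕ => √(M : ℝ) * δ M) atTop (𝓝 ((A - B) / (2 * C) * x)) :=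
    ((tendsto_sqrt_mul_sin_div_sqrt x).const_mul ((A - B) / (2 * C))).congr fun M => by
      simp only [hδ]; ring
  have hg0 : Tendsto g atTop (𝓝 0) := by
    simpa [hg, add_comm] using ((((hsin (x / 2)).pow 2).const_mul (2 * (A + B))).add
      ((hδ0.pow 2).const_mul (2 * C))).neg
  have hg1 : Tendsto (fun M : ℕ => M * g M) atTop
      (𝓝 (-((A - B) ^ 2 / C + (A + B)) * x ^ 2 / 2)) := by
    have := ((((tendsto_sqrt_mul_sin_div_sqrt (x / 2)).pow 2).const_mul (2 * (A + B))).add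
      ((hδ1.pow 2).const_mul (2 * C))).neg
    convert this using 2
    · rename_i M
      simp only [hg, mul_pow, Real.sq_sqrt (Nat.cast_nonneg M)]
      ring
    · field_simp
      ring
  have hpow := (Complex.continuous_ofReal.tendsto _).comp
    (tendsto_one_add_pow_nat_floor ht hg1 hg0)
  have herr : Tendsto (fun M : ℕ => 2 * |δ M| + (⌊(M : ℝ) * t⌋₊ : ℝ) * (2 * C * |δ M| ^ 3))
      atTop (𝓝 0) := by
    have h3 := ((tendsto_nat_floor_natCast_mul_div ht).mul ((hδ1.pow 2).mul hδ0.abs)).const_mul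
      (2 * C)
    rw [abs_zero, mul_zero, mul_zero, mul_zero] at h3
    have := (hδ0.abs.const_mul 2).add h3
    rw [abs_zero, mul_zero, add_zero] at this
    refine this.congr' ?_
    filter_upwards [eventually_gt_atTop 0] with M hM
    have hM' : (M : ℝ) ≠ 0 := by positivity
    rw [mul_pow, Real.sq_sqrt (Nat.cast_nonneg M), ← sq_abs (δ M)]
    field_simp
  have hdiff : Tendsto (fun M : ℕ => ∫ ω, dbdChar (x / √(M : ℝ))
        (X ⌊(M : ℝ) * t⌋₊ ω, Y ⌊(M : ℝ) * t⌋₊ ω) ∂μ - ((1 + g M) ^ ⌊(M : ℝ) * t⌋₊ : ℝ))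
      atTop (𝓝 0) := by
    refine squeeze_zero_norm' ?_ herr
    filter_upwards [hg0.eventually_const_lt (show (-1 : ℝ) < 0 by simp)] with M hM
    rw [Complex.ofReal_pow]
    refine h.norm_integral_dbdChar_sub_pow_le hA hB hC _ _ (δ M) (1 + g M) ?_ ?_ ?_
    · simp only [hδ]
      field_simp
    · have hcos : Real.cos (x / √(M : ℝ)) = 1 - 2 * Real.sin (x / 2 / √(M : ℝ)) ^ 2 := by
        rw [← Real.cos_two_mul_eq_one_sub]
        congr 1
        ring
      rw [hcos]
      simp only [hg]
      linear_combination -hsum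
    · have : g M ≤ 0 := by
        simp only [hg]
        exact neg_nonpos.2 (by positivity)
      exact abs_le.2 ⟨by linarith, by linarith⟩
  simpa using hdiff.add hpow

/-- functional CLT marginal. For each fixed t > 0, the random
variables X_{⌊Mt⌋}/√M converge weakly, as M → ∞ through the positive integers,
to N(0, v t), where v = (A−B)²/C + (A+B). Weak convergence is expressed by
convergence of integrals of every bounded continuous function. -/
theorem dbd_clt
    (A B C : ℝ) (hA : 0 ≤ A) (hB : 0 ≤ B) (hC : 0 < C) (hsum : A + B + C = 1)
    {Ω : Type*} [MeasurableSpace Ω] (μ : Measure Ω) [IsProbabilityMeasure μ]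
    (X : ℕ → Ω → ℤ) (Y : ℕ → Ω → Bool)
    (hchain : IsDBDChain μ A B C X Y)
    (v : ℝ) (hv : v = (A - B) ^ 2 / C + (A + B)) :
    ∀ t : ℝ, 0 < t → ∀ f : BoundedContinuousFunction ℝ ℝ,
      Filter.Tendsto
        (fun M : ℕ => ∫ ω, f (((X (⌊(M : ℝ) * t⌋₊) ω : ℤ) : ℝ) / Real.sqrt M) ∂μ)
        Filter.atTop
        (nhds (∫ x, f x ∂(gaussianReal 0 (Real.toNNReal (v * t))))) := by
  intro t ht f
  have hm (M : ℕ) : Measurable fun ω => ((X ⌊(M : ℝ) * t⌋₊ ω : ℤ) : ℝ) / Real.sqrt M :=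
    ((measurable_of_countable fun i : ℤ => (i : ℝ)).comp (hchain.1 _)).div_const _
  let P (M : ℕ) : ProbabilityMeasure ℝ :=
    ⟨μ.map fun ω => ((X ⌊(M : ℝ) * t⌋₊ ω : ℤ) : ℝ) / Real.sqrt M,
      Measure.isProbabilityMeasure_map (hm M).aemeasurable⟩
  let Q : ProbabilityMeasure ℝ := ⟨gaussianReal 0 (Real.toNNReal (v * t)), inferInstance⟩
  have hPQ : Filter.Tendsto P Filter.atTop (nhds Q) := by
    refine ProbabilityMeasure.tendsto_iff_tendsto_charFun.2 fun x => ?_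
    have hv0 : 0 ≤ v * t := by rw [hv]; positivity
    have hQ : charFun (Q : Measure ℝ) x =
        (Real.exp (t * (-((A - B) ^ 2 / C + (A + B)) * x ^ 2 / 2)) : ℝ) := by
      simp only [Q, ProbabilityMeasure.coe_mk, charFun_gaussianReal, Real.coe_toNNReal _ hv0]
      rw [← hv]
      push_cast
      congr 1
      ring
    rw [hQ]
    refine (hchain.tendsto_integral_dbdChar hA hB hC hsum ht.le x).congr fun M => ?_
    simp only [P, ProbabilityMeasure.coe_mk, charFun_apply_real]
    rw [integral_map (hm M).aemeasurable (by fun_prop)]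
    refine integral_congr_ae (Filter.Eventually.of_forall fun ω => ?_)
    simp only [dbdChar]
    congr 1
    push_cast
    ring
  refine (ProbabilityMeasure.tendsto_iff_forall_integral_tendsto.1 hPQ f).congr fun M => ?_
  exact integral_map (hm M).aemeasurable f.continuous.aestronglyMeasurable
end

section
/- The function g(s) = s²·Φ(−s) attains its maximum over (0,∞) at a unique point s*, and this point satisfies 1.190 < s* < 1.191; moreover 0.2338 < 2·Φ(−s*) < 0.2340, and the corresponding optimal reversible efficiency satisfies 1.32 < 8·(s*)²·Φ(−s*) < 1.33. -/
/-- The standard normal cumulative distribution function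
Phi(z) = int_{-infty}^z (1/sqrt(2 pi)) exp(-u^2/2) du. -/
noncomputable def Phi (z : ℝ) : ℝ :=
  ∫ u in Set.Iic z, (Real.sqrt (2 * Real.pi))⁻¹ * Real.exp (-u ^ 2 / 2)

open MeasureTheory Filter Topology

/-- The standard normal density. -/
noncomputable def gaussDensity (u : ℝ) : ℝ :=
  (Real.sqrt (2 * Real.pi))⁻¹ * Real.exp (-u ^ 2 / 2)

/-- A positive multiple of the derivative of `s ↦ s ^ 2 * Phi (-s)`. -/
noncomputable def efficiencySlope (s : ℝ) : ℝ :=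
  2 * Phi (-s) - s * gaussDensity s

lemma gaussDensity_pos (u : ℝ) : 0 < gaussDensity u := by
  unfold gaussDensity; positivity

lemma continuous_gaussDensity : Continuous gaussDensity := by
  unfold gaussDensity; fun_prop

lemma integrable_gaussDensity : Integrable gaussDensity := by
  have h := (integrable_exp_neg_mul_sq (b := 1 / 2) (by norm_num)).const_mul
    (Real.sqrt (2 * Real.pi))⁻¹
  refine h.congr (Eventually.of_forall fun x => ?_)
  simp only [gaussDensity]
  ring_nf

lemma Phi_neg_eq_integral_Ioi (s : ℝ) : Phi (-s) = ∫ u in Set.Ioi s, gaussDensity u := by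
  have h := integral_comp_neg_Ioi s gaussDensity
  rw [show Phi (-s) = ∫ u in Set.Iic (-s), gaussDensity u from rfl, ← h]
  simp [gaussDensity]

lemma integral_Ioi_zero_gaussDensity : ∫ u in Set.Ioi (0 : ℝ), gaussDensity u = 1 / 2 := by
  have h := integral_gaussian_Ioi (1 / 2)
  have hexp : ∀ u : ℝ, -u ^ 2 / 2 = -(1 / 2) * u ^ 2 := fun u => by ring
  simp only [gaussDensity, hexp]
  rw [integral_const_mul, h, show Real.pi / (1 / 2) = 2 * Real.pi by ring]
  have : Real.sqrt (2 * Real.pi) ≠ 0 := by positivity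
  field_simp

lemma Phi_neg_eq (s : ℝ) : Phi (-s) = 1 / 2 - ∫ u in (0 : ℝ)..s, gaussDensity u := by
  have h := intervalIntegral.integral_interval_add_Ioi (a := 0) (b := s)
    integrable_gaussDensity.integrableOn integrable_gaussDensity.integrableOn
  rw [integral_Ioi_zero_gaussDensity, ← Phi_neg_eq_integral_Ioi] at h
  linarith

lemma hasDerivAt_Phi_neg (s : ℝ) : HasDerivAt (fun s => Phi (-s)) (-gaussDensity s) s := by
  have h : HasDerivAt (fun s => ∫ u in (0 : ℝ)..s, gaussDensity u) (gaussDensity s) s :=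
    intervalIntegral.integral_hasDerivAt_right
      (continuous_gaussDensity.intervalIntegrable _ _)
      (continuous_gaussDensity.stronglyMeasurableAtFilter _ _)
      continuous_gaussDensity.continuousAt
  rw [funext Phi_neg_eq]
  exact h.const_sub (1 / 2)

lemma strictAnti_Phi_neg : StrictAnti fun s => Phi (-s) :=
  strictAnti_of_deriv_neg fun s => by
    rw [(hasDerivAt_Phi_neg s).deriv]
    linarith [gaussDensity_pos s]

lemma tendsto_Phi_neg_atTop : Tendsto (fun s => Phi (-s)) atTop (𝓝 0) := by
  have h := intervalIntegral_tendsto_integral_Ioi (0 : ℝ)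
    integrable_gaussDensity.integrableOn tendsto_id
  rw [integral_Ioi_zero_gaussDensity] at h
  rw [funext Phi_neg_eq]
  exact (sub_self (1 / 2 : ℝ)) ▸ h.const_sub (1 / 2 : ℝ)

lemma hasDerivAt_gaussDensity (s : ℝ) :
    HasDerivAt gaussDensity (-s * gaussDensity s) s := by
  have h : HasDerivAt (fun u : ℝ => -u ^ 2 / 2) (-s) s := by
    convert! ((hasDerivAt_pow 2 s).neg).div_const 2 using 1
    norm_num
    ring
  convert! h.exp.const_mul (Real.sqrt (2 * Real.pi))⁻¹ using 1
  simp only [gaussDensity]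
  ring

lemma hasDerivAt_efficiencySlope (s : ℝ) :
    HasDerivAt efficiencySlope ((s ^ 2 - 3) * gaussDensity s) s := by
  convert! ((hasDerivAt_Phi_neg s).const_mul 2).sub
    ((hasDerivAt_id s).mul (hasDerivAt_gaussDensity s)) using 1
  simp only [id]
  ring

lemma continuous_efficiencySlope : Continuous efficiencySlope :=
  continuous_iff_continuousAt.2 fun s => (hasDerivAt_efficiencySlope s).continuousAt

lemma strictAntiOn_efficiencySlope :
    StrictAntiOn efficiencySlope (Set.Icc 0 (Real.sqrt 3)) := by
  refine strictAntiOn_of_deriv_neg (convex_Icc _ _) continuous_efficiencySlope.continuousOn ?_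
  intro s hs
  rw [interior_Icc] at hs
  rw [(hasDerivAt_efficiencySlope s).deriv]
  have : s ^ 2 < 3 := (Real.lt_sqrt hs.1.le).1 hs.2
  exact mul_neg_of_neg_of_pos (by linarith) (gaussDensity_pos s)

lemma strictMonoOn_efficiencySlope :
    StrictMonoOn efficiencySlope (Set.Ici (Real.sqrt 3)) := by
  refine strictMonoOn_of_deriv_pos (convex_Ici _) continuous_efficiencySlope.continuousOn ?_
  intro s hs
  rw [interior_Ici] at hs
  rw [(hasDerivAt_efficiencySlope s).deriv]
  have : 3 < s ^ 2 := (Real.sqrt_lt' ((Real.sqrt_nonneg 3).trans_lt hs)).1 hs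
  exact mul_pos (by linarith) (gaussDensity_pos s)

lemma efficiencySlope_neg_of_sqrt_three_le {s : ℝ} (hs : Real.sqrt 3 ≤ s) :
    efficiencySlope s < 0 := by
  by_contra! h
  have hpos : 0 < efficiencySlope (s + 1) :=
    h.trans_lt (strictMonoOn_efficiencySlope hs (by simp only [Set.mem_Ici]; linarith)
      (by linarith))
  have hle : ∀ᶠ t in atTop, efficiencySlope (s + 1) ≤ 2 * Phi (-t) := by
    filter_upwards [eventually_ge_atTop (s + 1)] with t ht
    have h₁ : efficiencySlope (s + 1) ≤ efficiencySlope t :=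
      strictMonoOn_efficiencySlope.monotoneOn (by simp only [Set.mem_Ici]; linarith)
        (by simp only [Set.mem_Ici]; linarith) ht
    have h₂ : 0 ≤ t * gaussDensity t :=
      mul_nonneg (by linarith [Real.sqrt_nonneg 3]) (gaussDensity_pos t).le
    have h₃ : efficiencySlope t = 2 * Phi (-t) - t * gaussDensity t := rfl
    linarith
  have hlim := ge_of_tendsto (tendsto_Phi_neg_atTop.const_mul 2) hle
  linarith

lemma hasDerivAt_sq_mul_Phi_neg (s : ℝ) :
    HasDerivAt (fun s => s ^ 2 * Phi (-s)) (s * efficiencySlope s) s := by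
  convert! (hasDerivAt_pow 2 s).mul (hasDerivAt_Phi_neg s) using 1
  simp only [efficiencySlope]
  push_cast
  ring

/-- A zero of the slope below `√3` is the strict global maximiser on `(0, ∞)`. -/
lemma sq_mul_Phi_neg_lt_of_efficiencySlope_eq_zero {s x : ℝ} (hs0 : 0 < s)
    (hs3 : s ≤ Real.sqrt 3) (hs : efficiencySlope s = 0) (hx : 0 < x) (hxs : x ≠ s) :
    x ^ 2 * Phi (-x) < s ^ 2 * Phi (-s) := by
  have hcont : Continuous fun s => s ^ 2 * Phi (-s) :=
    continuous_iff_continuousAt.2 fun s => (hasDerivAt_sq_mul_Phi_neg s).continuousAt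
  rcases lt_or_gt_of_ne hxs with hlt | hgt
  · refine strictMonoOn_of_deriv_pos (convex_Icc 0 s) hcont.continuousOn (fun t ht => ?_)
      ⟨hx.le, hlt.le⟩ ⟨hs0.le, le_rfl⟩ hlt
    rw [interior_Icc] at ht
    rw [(hasDerivAt_sq_mul_Phi_neg t).deriv]
    refine mul_pos ht.1 ?_
    rw [← hs]
    exact strictAntiOn_efficiencySlope ⟨ht.1.le, ht.2.le.trans hs3⟩ ⟨hs0.le, hs3⟩ ht.2
  · refine strictAntiOn_of_deriv_neg (convex_Ici s) hcont.continuousOn (fun t ht => ?_)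
      Set.self_mem_Ici hgt.le hgt
    rw [interior_Ici] at ht
    have hst : s < t := ht
    rw [(hasDerivAt_sq_mul_Phi_neg t).deriv]
    refine mul_neg_of_pos_of_neg (hs0.trans hst) ?_
    rcases le_total (Real.sqrt 3) t with h | h
    · exact efficiencySlope_neg_of_sqrt_three_le h
    · rw [← hs]
      exact strictAntiOn_efficiencySlope ⟨hs0.le, hs3⟩ ⟨(hs0.trans hst).le, h⟩ hst

lemma abs_exp_neg_sq_div_two_sub_le {u : ℝ} (hu : u ^ 2 ≤ 2) {n : ℕ} (hn : 0 < n) :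
    |Real.exp (-u ^ 2 / 2) - ∑ m ∈ Finset.range n, (-1 / 2) ^ m / m.factorial * u ^ (2 * m)| ≤
      u ^ (2 * n) * ((1 / 2) ^ n * (n.succ / (n.factorial * n))) := by
  have habs : |-u ^ 2 / 2| = 1 / 2 * u ^ 2 := by
    rw [show -u ^ 2 / 2 = -(1 / 2 * u ^ 2) by ring, abs_neg, abs_of_nonneg (by positivity)]
  have h := Real.exp_bound (x := -u ^ 2 / 2) (by rw [habs]; linarith) hn
  rw [habs] at h
  convert h using 1
  · congr 2
    refine Finset.sum_congr rfl fun m _ => ?_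
    rw [show -u ^ 2 / 2 = (-1 / 2) * u ^ 2 by ring, mul_pow, ← pow_mul]
    ring
  · rw [mul_pow, ← pow_mul]
    ring

lemma abs_integral_exp_neg_sq_div_two_sub_le {a : ℝ} (ha : 0 ≤ a) (ha2 : a ^ 2 ≤ 2) {n : ℕ}
    (hn : 0 < n) :
    |(∫ u in (0 : ℝ)..a, Real.exp (-u ^ 2 / 2)) -
        ∑ m ∈ Finset.range n, (-1 / 2) ^ m / m.factorial * (a ^ (2 * m + 1) / (2 * m + 1))| ≤
      a ^ (2 * n + 1) / (2 * n + 1) * ((1 / 2) ^ n * (n.succ / (n.factorial * n))) := by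
  have hpow : ∀ k : ℕ, ∫ u in (0 : ℝ)..a, u ^ (2 * k) = a ^ (2 * k + 1) / (2 * k + 1) := by
    intro k
    rw [integral_pow]
    simp
  have hsum : ∫ u in (0 : ℝ)..a, ∑ m ∈ Finset.range n, (-1 / 2) ^ m / m.factorial * u ^ (2 * m) =
      ∑ m ∈ Finset.range n, (-1 / 2) ^ m / m.factorial * (a ^ (2 * m + 1) / (2 * m + 1)) := by
    rw [intervalIntegral.integral_finsetSum
      fun m _ => Continuous.intervalIntegrable (by fun_prop) _ _]
    simp only [intervalIntegral.integral_const_mul, hpow]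
  rw [← hsum, ← hpow, ← intervalIntegral.integral_mul_const, ← intervalIntegral.integral_sub
    (Continuous.intervalIntegrable (by fun_prop) _ _)
    (Continuous.intervalIntegrable (by fun_prop) _ _), ← Real.norm_eq_abs]
  refine intervalIntegral.norm_integral_le_of_norm_le ha (Eventually.of_forall fun u hu => ?_)
    (Continuous.intervalIntegrable (by fun_prop) _ _)
  rw [Real.norm_eq_abs]
  refine abs_exp_neg_sq_div_two_sub_le ?_ hn
  exact (pow_le_pow_left₀ hu.1.le hu.2 2).trans ha2

lemma sqrt_two_pi_gt : 2.5066282 < Real.sqrt (2 * Real.pi) :=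
  Real.lt_sqrt_of_sq_lt (by linarith [Real.pi_gt_d20])

lemma sqrt_two_pi_lt : Real.sqrt (2 * Real.pi) < 2.5066283 := by
  rw [Real.sqrt_lt' (by norm_num)]
  linarith [Real.pi_lt_d20]

lemma two_mul_Phi_neg_mul_sqrt (s : ℝ) :
    2 * Phi (-s) * Real.sqrt (2 * Real.pi) =
      Real.sqrt (2 * Real.pi) - 2 * ∫ u in (0 : ℝ)..s, Real.exp (-u ^ 2 / 2) := by
  have : Real.sqrt (2 * Real.pi) ≠ 0 := by positivity
  rw [Phi_neg_eq]
  simp only [gaussDensity, intervalIntegral.integral_const_mul]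
  field_simp

lemma efficiencySlope_mul_sqrt (s : ℝ) :
    efficiencySlope s * Real.sqrt (2 * Real.pi) =
      Real.sqrt (2 * Real.pi) - 2 * (∫ u in (0 : ℝ)..s, Real.exp (-u ^ 2 / 2)) -
        s * Real.exp (-s ^ 2 / 2) := by
  have : Real.sqrt (2 * Real.pi) ≠ 0 := by positivity
  rw [efficiencySlope, sub_mul, two_mul_Phi_neg_mul_sqrt, gaussDensity]
  field_simp

lemma slope_pos_and_two_mul_Phi_neg_lt :
    0 < efficiencySlope 1.1905 ∧ 2 * Phi (-1.1905) < 0.2340 := by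
  have hI := abs_le.1 (abs_integral_exp_neg_sq_div_two_sub_le (a := 1.1905) (by norm_num)
    (by norm_num) (n := 10) (by norm_num))
  have hE := abs_le.1 (abs_exp_neg_sq_div_two_sub_le (u := 1.1905) (by norm_num)
    (n := 10) (by norm_num))
  have hs := efficiencySlope_mul_sqrt 1.1905
  have hP := two_mul_Phi_neg_mul_sqrt 1.1905
  set I := ∫ u in (0 : ℝ)..1.1905, Real.exp (-u ^ 2 / 2)
  set E := Real.exp (-1.1905 ^ 2 / 2)
  norm_num [Finset.sum_range_succ, Nat.factorial] at hI hE
  have h₁ := sqrt_two_pi_gt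
  have h₂ := sqrt_two_pi_lt
  have h₀ : 0 < Real.sqrt (2 * Real.pi) := by positivity
  constructor
  · refine pos_of_mul_pos_left ?_ h₀.le
    rw [hs]
    linarith [hI.2, hE.2]
  · refine lt_of_mul_lt_mul_right ?_ h₀.le
    rw [hP]
    linarith [hI.1]

lemma slope_neg_and_lt_two_mul_Phi_neg :
    efficiencySlope 1.19061 < 0 ∧ 0.2338 < 2 * Phi (-1.19061) := by
  have hI := abs_le.1 (abs_integral_exp_neg_sq_div_two_sub_le (a := 1.19061) (by norm_num)
    (by norm_num) (n := 10) (by norm_num))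
  have hE := abs_le.1 (abs_exp_neg_sq_div_two_sub_le (u := 1.19061) (by norm_num)
    (n := 10) (by norm_num))
  have hs := efficiencySlope_mul_sqrt 1.19061
  have hP := two_mul_Phi_neg_mul_sqrt 1.19061
  set I := ∫ u in (0 : ℝ)..1.19061, Real.exp (-u ^ 2 / 2)
  set E := Real.exp (-1.19061 ^ 2 / 2)
  norm_num [Finset.sum_range_succ, Nat.factorial] at hI hE
  have h₁ := sqrt_two_pi_gt
  have h₂ := sqrt_two_pi_lt
  have h₀ : 0 < Real.sqrt (2 * Real.pi) := by positivity
  constructor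
  · refine neg_of_mul_neg_left ?_ h₀.le
    rw [hs]
    linarith [hI.1, hE.1]
  · refine lt_of_mul_lt_mul_right ?_ h₀.le
    rw [hP]
    linarith [hI.2]

/-- the function g(s) = s^2 * Phi(-s) attains its maximum over
(0,∞) at a unique point s*, with 1.190 < s* < 1.191,
0.2338 < 2 Phi(-s*) < 0.2340, and 1.32 < 8 (s*)^2 Phi(-s*) < 1.33. -/
theorem reversible_optimal_scaling :
    ∃ s : ℝ, (s ∈ Set.Ioi (0:ℝ) ∧ IsMaxOn (fun s : ℝ => s ^ 2 * Phi (-s)) (Set.Ioi 0) s) ∧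
      (∀ s' : ℝ, s' ∈ Set.Ioi (0:ℝ) ∧ IsMaxOn (fun s : ℝ => s ^ 2 * Phi (-s)) (Set.Ioi 0) s' → s' = s) ∧
      (1.190 < s ∧ s < 1.191) ∧
      (0.2338 < 2 * Phi (-s) ∧ 2 * Phi (-s) < 0.2340) ∧
      (1.32 < 8 * s ^ 2 * Phi (-s) ∧ 8 * s ^ 2 * Phi (-s) < 1.33) := by
  obtain ⟨hpos, hPhi_lt⟩ := slope_pos_and_two_mul_Phi_neg_lt
  obtain ⟨hneg, hlt_Phi⟩ := slope_neg_and_lt_two_mul_Phi_neg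
  obtain ⟨s, ⟨hs₁, hs₂⟩, hs⟩ := intermediate_value_Ioo' (by norm_num : (1.1905 : ℝ) ≤ 1.19061)
    continuous_efficiencySlope.continuousOn ⟨hneg, hpos⟩
  have hs0 : 0 < s := by linarith
  have hs3 : s ≤ Real.sqrt 3 := Real.le_sqrt_of_sq_le (by nlinarith)
  have hmax : ∀ x : ℝ, 0 < x → x ≠ s → x ^ 2 * Phi (-x) < s ^ 2 * Phi (-s) := fun x hx hxs =>
    sq_mul_Phi_neg_lt_of_efficiencySlope_eq_zero hs0 hs3 hs hx hxs
  have hlower : 0.2338 < 2 * Phi (-s) := by linarith [strictAnti_Phi_neg hs₂]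
  have hupper : 2 * Phi (-s) < 0.2340 := by linarith [strictAnti_Phi_neg hs₁]
  have hsq₁ : 1.1905 ^ 2 < s ^ 2 := pow_lt_pow_left₀ hs₁ (by norm_num) two_ne_zero
  have hsq₂ : s ^ 2 < 1.19061 ^ 2 := pow_lt_pow_left₀ hs₂ hs0.le two_ne_zero
  refine ⟨s, ⟨hs0, fun x hx => ?_⟩, fun x hx => ?_, ⟨by linarith, by linarith⟩,
    ⟨hlower, hupper⟩, ?_, ?_⟩
  · rcases eq_or_ne x s with hxs | hxs
    · simp [hxs]
    · exact (hmax x hx hxs).le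
  · by_contra hxs
    exact (hmax x hx.1 hxs).not_ge (hx.2 hs0)
  · nlinarith
  · nlinarith
end

section
/- Let M₁ = sup_{s>0} s²·Φ(−s) and M₂ = sup_{s>0} s²·Φ(−s)/(1 − 2·Φ(−s)). Then 1.42 < M₂/M₁ < 1.43; i.e., the optimally scaled non-reversible tempering algorithm is approximately 42% more efficient than the optimally scaled reversible one. -/
open MeasureTheory Set Filter Topology

/-- The Taylor polynomial of `∫ u in 0..s, exp (-u ^ 2 / 2)` with `n` terms. -/
noncomputable def erfTaylor (n : ℕ) (s : ℝ) : ℝ :=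
  ∑ k ∈ Finset.range n, (-1) ^ k * s ^ (2 * k + 1) / ((2 * k + 1) * 2 ^ k * k.factorial)

/-- The partial sums of the alternating series of `exp (-x)` bracket it. -/
theorem exp_neg_taylor_alternating (n : ℕ) {x : ℝ} (hx : 0 ≤ x) :
    0 ≤ (-1) ^ n * (Real.exp (-x) - ∑ k ∈ Finset.range n, (-x) ^ k / k.factorial) := by
  induction n generalizing x with
  | zero => simpa using (Real.exp_pos _).le
  | succ n ih =>
    let f : ℝ → ℝ := fun y =>
      (-1) ^ (n + 1) * (Real.exp (-y) - ∑ k ∈ Finset.range (n + 1), (-y) ^ k / k.factorial)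
    have hf (y : ℝ) : HasDerivAt f
        ((-1) ^ n * (Real.exp (-y) - ∑ k ∈ Finset.range n, (-y) ^ k / k.factorial)) y := by
      have h1 : HasDerivAt (fun z : ℝ => ∑ k ∈ Finset.range (n + 1), (-z) ^ k / k.factorial)
          (∑ k ∈ Finset.range (n + 1), k * (-y) ^ (k - 1) * (-1) / k.factorial) y :=
        HasDerivAt.fun_sum fun k _ => (((hasDerivAt_id y).neg).pow k).div_const _
      have h2 : ∑ k ∈ Finset.range (n + 1), k * (-y) ^ (k - 1) * (-1) / (k.factorial : ℝ) =
          -∑ k ∈ Finset.range n, (-y) ^ k / k.factorial := by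
        rw [Finset.sum_range_succ', ← Finset.sum_neg_distrib]
        simp only [Nat.cast_zero, zero_mul, zero_div, add_zero]
        refine Finset.sum_congr rfl fun k _ => ?_
        rw [Nat.factorial_succ, Nat.add_sub_cancel]
        push_cast
        field_simp
      rw [h2] at h1
      have h3 := (((hasDerivAt_id y).neg.exp).sub h1).const_mul ((-1 : ℝ) ^ (n + 1))
      refine h3.congr_deriv ?_
      simp only [Pi.neg_apply, id]
      ring
    have hmono : MonotoneOn f (Ici 0) := by
      refine monotoneOn_of_deriv_nonneg (convex_Ici 0)
        (fun y _ => (hf y).continuousAt.continuousWithinAt)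
        (fun y _ => (hf y).differentiableAt.differentiableWithinAt) fun y hy => ?_
      rw [(hf y).deriv]
      rw [interior_Ici] at hy
      exact ih (le_of_lt hy)
    have h0 : f 0 = 0 := by
      simp [f, Finset.sum_range_succ']
    calc (0 : ℝ) = f 0 := h0.symm
      _ ≤ f x := hmono self_mem_Ici hx hx

theorem integral_taylor (n : ℕ) (s : ℝ) :
    ∫ u in (0 : ℝ)..s, ∑ k ∈ Finset.range n, (-(u ^ 2 / 2)) ^ k / k.factorial = erfTaylor n s := by
  rw [intervalIntegral.integral_finsetSum
    fun k _ => Continuous.intervalIntegrable (by fun_prop) _ _, erfTaylor]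
  refine Finset.sum_congr rfl fun k _ => ?_
  have h (u : ℝ) : (-(u ^ 2 / 2)) ^ k / (k.factorial : ℝ) =
      (-1) ^ k / (2 ^ k * k.factorial) * u ^ (2 * k) := by
    rw [neg_pow, div_pow, ← pow_mul]
    field_simp
  simp_rw [h]
  rw [intervalIntegral.integral_const_mul, integral_pow]
  push_cast
  field_simp
  simp

theorem erfTaylor_alternating (n : ℕ) {s : ℝ} (hs : 0 ≤ s) :
    0 ≤ (-1) ^ n * ((∫ u in (0 : ℝ)..s, Real.exp (-u ^ 2 / 2)) - erfTaylor n s) := by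
  rw [← integral_taylor, ← intervalIntegral.integral_sub
    (Continuous.intervalIntegrable (by fun_prop) _ _)
    (Continuous.intervalIntegrable (by fun_prop) _ _),
    ← intervalIntegral.integral_const_mul]
  refine intervalIntegral.integral_nonneg hs fun u _ => ?_
  rw [neg_div]
  exact exp_neg_taylor_alternating n (by positivity)

theorem integrable_exp_neg_sq_div_two : Integrable fun u : ℝ => Real.exp (-u ^ 2 / 2) := by
  refine (integrable_exp_neg_mul_sq (b := 1 / 2) (by norm_num)).congr (.of_forall fun u => ?_)
  simp only
  ring_nf

theorem Phi_neg_eq_s8 (s : ℝ) :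
    Phi (-s) = 1 / 2 - (Real.sqrt (2 * Real.pi))⁻¹ * ∫ u in (0 : ℝ)..s, Real.exp (-u ^ 2 / 2) := by
  have h0 : ∫ u in Iic (0 : ℝ), Real.exp (-u ^ 2 / 2) = Real.sqrt (2 * Real.pi) / 2 := by
    have h1 := integral_comp_neg_Iic 0 fun u : ℝ => Real.exp (-u ^ 2 / 2)
    have h2 := integral_gaussian_Ioi (1 / 2)
    simp only [neg_sq, neg_zero] at h1
    rw [h1, show 2 * Real.pi = Real.pi / (1 / 2) by ring, ← h2]
    refine integral_congr_ae (.of_forall fun u => ?_)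
    simp only
    ring_nf
  have h1 := intervalIntegral.integral_Iic_sub_Iic (μ := volume) (a := -s) (b := 0)
    integrable_exp_neg_sq_div_two.integrableOn integrable_exp_neg_sq_div_two.integrableOn
  have h2 := intervalIntegral.integral_comp_neg (a := 0) (b := s)
    fun u : ℝ => Real.exp (-u ^ 2 / 2)
  simp only [neg_sq, neg_zero] at h2
  rw [← h2, h0] at h1
  have hpos : 0 < Real.sqrt (2 * Real.pi) := by positivity
  rw [Phi, integral_const_mul, ← sub_eq_iff_eq_add'.2 (sub_eq_iff_eq_add.1 h1)]
  field_simp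

theorem inv_sqrt_two_pi_bounds :
    3989 / 10000 ≤ (Real.sqrt (2 * Real.pi))⁻¹ ∧ (Real.sqrt (2 * Real.pi))⁻¹ ≤ 399 / 1000 := by
  have h1 := Real.pi_gt_d4
  have h2 := Real.pi_lt_d4
  have hpos : 0 < Real.sqrt (2 * Real.pi) := by positivity
  constructor
  · rw [le_inv_comm₀ (by norm_num) hpos, Real.sqrt_le_iff]
    constructor
    · norm_num
    · norm_num at *
      linarith
  · rw [inv_le_comm₀ hpos (by norm_num)]
    apply Real.le_sqrt_of_sq_le
    norm_num at *
    linarith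

theorem integral_exp_neg_sq_pos {s : ℝ} (hs : 0 < s) :
    0 < ∫ u in (0 : ℝ)..s, Real.exp (-u ^ 2 / 2) :=
  intervalIntegral.intervalIntegral_pos_of_pos
    (Continuous.intervalIntegrable (by fun_prop) _ _) (fun _ => Real.exp_pos _) hs

theorem Phi_neg_lt_half {s : ℝ} (hs : 0 < s) : Phi (-s) < 1 / 2 := by
  rw [Phi_neg_eq_s8]
  have := integral_exp_neg_sq_pos hs
  have : 0 < (Real.sqrt (2 * Real.pi))⁻¹ * ∫ u in (0 : ℝ)..s, Real.exp (-u ^ 2 / 2) := by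
    positivity
  linarith

theorem Phi_neg_le_erfTaylor {s : ℝ} (hs : 0 < s) :
    Phi (-s) ≤ 1 / 2 - 3989 / 10000 * erfTaylor 6 s := by
  have h1 := erfTaylor_alternating 6 hs.le
  have h2 := mul_le_mul_of_nonneg_right inv_sqrt_two_pi_bounds.1 (integral_exp_neg_sq_pos hs).le
  rw [Phi_neg_eq_s8]
  linarith

theorem erfTaylor_le_Phi_neg {s : ℝ} (hs : 0 < s) :
    1 / 2 - 399 / 1000 * erfTaylor 5 s ≤ Phi (-s) := by
  have h1 := erfTaylor_alternating 5 hs.le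
  have h2 := mul_le_mul_of_nonneg_right inv_sqrt_two_pi_bounds.2 (integral_exp_neg_sq_pos hs).le
  rw [Phi_neg_eq_s8]
  linarith

/-- The Mills ratio bound for the Gaussian tail. -/
theorem Phi_neg_le_mills {s : ℝ} (hs : 0 < s) :
    Phi (-s) ≤ (Real.sqrt (2 * Real.pi))⁻¹ * (Real.exp (-s ^ 2 / 2) / s) := by
  rw [Phi, integral_const_mul]
  refine mul_le_mul_of_nonneg_left ?_ (by positivity)
  have hderiv (u : ℝ) : HasDerivAt (fun u : ℝ => Real.exp (-u ^ 2 / 2) / s)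
      (-u * Real.exp (-u ^ 2 / 2) / s) u := by
    refine (((((hasDerivAt_id u).pow 2).neg.div_const 2).exp).div_const s).congr_deriv ?_
    simp
    ring
  have hint : Integrable fun u : ℝ => -u * Real.exp (-u ^ 2 / 2) / s := by
    refine ((integrable_mul_exp_neg_mul_sq (b := 1 / 2) (by norm_num)).neg.div_const s).congr
      (.of_forall fun u => ?_)
    simp only [Pi.neg_apply]
    ring_nf
  have hlim : Tendsto (fun u : ℝ => Real.exp (-u ^ 2 / 2) / s) atBot (𝓝 0) := by
    have h : Tendsto (fun u : ℝ => -u ^ 2 / 2) atBot atBot :=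
      (tendsto_neg_atTop_atBot.comp
        ((tendsto_id.atBot_mul_atBot₀ tendsto_id).congr fun u => (sq u).symm)).atBot_div_const
        two_pos
    simpa using (Real.tendsto_exp_atBot.comp h).div_const s
  have hval := integral_Iic_of_hasDerivAt_of_tendsto' (a := -s) (fun u _ => hderiv u)
    hint.integrableOn hlim
  rw [neg_sq, sub_zero] at hval
  rw [← hval]
  refine setIntegral_mono_on integrable_exp_neg_sq_div_two.integrableOn hint.integrableOn
    measurableSet_Iic fun u hu => ?_
  rw [le_div_iff₀ hs, mul_comm]
  exact mul_le_mul_of_nonneg_right (by linarith [mem_Iic.1 hu]) (Real.exp_pos _).le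

/-- A polynomial version of the Mills ratio bound. -/
theorem Phi_neg_mul_le {s : ℝ} (hs : 0 < s) :
    Phi (-s) * (s * (1 + s ^ 2 / 2 + (s ^ 2 / 2) ^ 2 / 2)) ≤ 399 / 1000 := by
  have h1 := Phi_neg_le_mills hs
  have h2 := Real.quadratic_le_exp_of_nonneg (x := s ^ 2 / 2) (by positivity)
  have h3 : Real.exp (-s ^ 2 / 2) * Real.exp (s ^ 2 / 2) = 1 := by
    rw [← Real.exp_add, neg_div, neg_add_cancel, Real.exp_zero]
  have hc : (0 : ℝ) ≤ (Real.sqrt (2 * Real.pi))⁻¹ := by positivity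
  calc Phi (-s) * (s * (1 + s ^ 2 / 2 + (s ^ 2 / 2) ^ 2 / 2))
      ≤ (Real.sqrt (2 * Real.pi))⁻¹ * (Real.exp (-s ^ 2 / 2) / s) *
          (s * Real.exp (s ^ 2 / 2)) := by gcongr
    _ = (Real.sqrt (2 * Real.pi))⁻¹ * (Real.exp (-s ^ 2 / 2) * Real.exp (s ^ 2 / 2)) := by
        field_simp
    _ ≤ 399 / 1000 := by rw [h3, mul_one]; exact inv_sqrt_two_pi_bounds.2

/-- Certified on each piece by nonnegative Bernstein coefficients. -/
theorem sq_mul_erfTaylor_le {s : ℝ} (hs : 0 ≤ s) (hs2 : s ≤ 2) :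
    s ^ 2 * (1 / 2 - 3989 / 10000 * erfTaylor 6 s) ≤ 1662 / 10000 := by
  rw [← sub_nonneg]
  rcases le_total s 1 with hb | ha1
  · have hu := sub_nonneg.2 hs
    have hv := sub_nonneg.2 hb
    have key : 1662 / 10000 - s ^ 2 * (1 / 2 - 3989 / 10000 * erfTaylor 6 s) =
        831 / 5000 * (1 - s) ^ 13 +
        10803 / 5000 * s * (1 - s) ^ 12 +
        31159 / 2500 * s ^ 2 * (1 - s) ^ 11 +
        424321 / 10000 * s ^ 3 * (1 - s) ^ 10 +
        47661 / 500 * s ^ 4 * (1 - s) ^ 9 +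
        1791401 / 12000 * s ^ 5 * (1 - s) ^ 8 +
        251303 / 1500 * s ^ 6 * (1 - s) ^ 7 +
        163339967 / 1200000 * s ^ 7 * (1 - s) ^ 6 +
        47855381 / 600000 * s ^ 8 * (1 - s) ^ 5 +
        7413631 / 224000 * s ^ 9 * (1 - s) ^ 4 +
        7873181 / 840000 * s ^ 10 * (1 - s) ^ 3 +
        410089811 / 241920000 * s ^ 11 * (1 - s) ^ 2 +
        104660863 / 604800000 * s ^ 12 * (1 - s) +
        1598363 / 212889600 * s ^ 13 := by
      simp only [erfTaylor, Finset.sum_range_succ, Finset.sum_range_zero, Nat.factorial]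
      push_cast
      ring
    rw [sub_zero] at hu
    rw [key]
    positivity
  rcases le_total s (5 / 4) with hb | ha2
  · have hu := sub_nonneg.2 ha1
    have hv := sub_nonneg.2 hb
    have key : 1662 / 10000 - s ^ 2 * (1 / 2 - 3989 / 10000 * erfTaylor 6 s) =
        26187579392 / 51975 * (5 / 4 - s) ^ 13 +
        3814569029632 / 721875 * (s - 1) * (5 / 4 - s) ^ 12 +
        32441586102272 / 1299375 * (s - 1) ^ 2 * (5 / 4 - s) ^ 11 +
        2755377625088 / 39375 * (s - 1) ^ 3 * (5 / 4 - s) ^ 10 +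
        3043983952448 / 23625 * (s - 1) ^ 4 * (5 / 4 - s) ^ 9 +
        4582365615568 / 28125 * (s - 1) ^ 5 * (5 / 4 - s) ^ 8 +
        28292226261056 / 196875 * (s - 1) ^ 6 * (5 / 4 - s) ^ 7 +
        3480614502248 / 39375 * (s - 1) ^ 7 * (5 / 4 - s) ^ 6 +
        1205295259037 / 31500 * (s - 1) ^ 8 * (5 / 4 - s) ^ 5 +
        4919002814779 / 378000 * (s - 1) ^ 9 * (5 / 4 - s) ^ 4 +
        3008771517097 / 630000 * (s - 1) ^ 10 * (5 / 4 - s) ^ 3 +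
        20252185826753 / 10395000 * (s - 1) ^ 11 * (5 / 4 - s) ^ 2 +
        3913979118561 / 7040000 * (s - 1) ^ 12 * (5 / 4 - s) +
        371343499981957 / 5322240000 * (s - 1) ^ 13 := by
      simp only [erfTaylor, Finset.sum_range_succ, Finset.sum_range_zero, Nat.factorial]
      push_cast
      ring
    rw [key]
    positivity
  rcases le_total s (3 / 2) with hb | ha3
  · have hu := sub_nonneg.2 ha2
    have hv := sub_nonneg.2 hb
    have key : 1662 / 10000 - s ^ 2 * (1 / 2 - 3989 / 10000 * erfTaylor 6 s) =
        371343499981957 / 5322240000 * (3 / 2 - s) ^ 13 +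
        3347981392949383 / 2661120000 * (s - (5 / 4)) * (3 / 2 - s) ^ 12 +
        6901631751312167 / 665280000 * (s - (5 / 4)) ^ 2 * (3 / 2 - s) ^ 11 +
        513577346469601 / 10080000 * (s - (5 / 4)) ^ 3 * (3 / 2 - s) ^ 10 +
        111425419119937 / 672000 * (s - (5 / 4)) ^ 4 * (3 / 2 - s) ^ 9 +
        635538758552911 / 1680000 * (s - (5 / 4)) ^ 5 * (3 / 2 - s) ^ 8 +
        131131897236007 / 210000 * (s - (5 / 4)) ^ 6 * (3 / 2 - s) ^ 7 +
        397653336840509 / 525000 * (s - (5 / 4)) ^ 7 * (3 / 2 - s) ^ 6 +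
        710891254089173 / 1050000 * (s - (5 / 4)) ^ 8 * (3 / 2 - s) ^ 5 +
        618094714289 / 1400 * (s - (5 / 4)) ^ 9 * (3 / 2 - s) ^ 4 +
        357968480187 / 1750 * (s - (5 / 4)) ^ 10 * (3 / 2 - s) ^ 3 +
        3073754159579 / 48125 * (s - (5 / 4)) ^ 11 * (3 / 2 - s) ^ 2 +
        2902565603271 / 240625 * (s - (5 / 4)) ^ 12 * (3 / 2 - s) +
        10027946778 / 9625 * (s - (5 / 4)) ^ 13 := by
      simp only [erfTaylor, Finset.sum_range_succ, Finset.sum_range_zero, Nat.factorial]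
      push_cast
      ring
    rw [key]
    positivity
  have hu := sub_nonneg.2 ha3
  have hv := sub_nonneg.2 hs2
  have key : 1662 / 10000 - s ^ 2 * (1 / 2 - 3989 / 10000 * erfTaylor 6 s) =
      5013973389 / 39424000 * (2 - s) ^ 13 +
      496514612751 / 246400000 * (s - (3 / 2)) * (2 - s) ^ 12 +
      1780051606873 / 123200000 * (s - (3 / 2)) ^ 2 * (2 - s) ^ 11 +
      174090349323 / 2800000 * (s - (3 / 2)) ^ 3 * (2 - s) ^ 10 +
      25120800589 / 140000 * (s - (3 / 2)) ^ 4 * (2 - s) ^ 9 +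
      192795958091 / 525000 * (s - (3 / 2)) ^ 5 * (2 - s) ^ 8 +
      72044794957 / 131250 * (s - (3 / 2)) ^ 6 * (2 - s) ^ 7 +
      39843759682 / 65625 * (s - (3 / 2)) ^ 7 * (2 - s) ^ 6 +
      32620036496 / 65625 * (s - (3 / 2)) ^ 8 * (2 - s) ^ 5 +
      156145408 / 525 * (s - (3 / 2)) ^ 9 * (2 - s) ^ 4 +
      24866068288 / 196875 * (s - (3 / 2)) ^ 10 * (2 - s) ^ 3 +
      46752351488 / 1299375 * (s - (3 / 2)) ^ 11 * (2 - s) ^ 2 +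
      39904520192 / 6496875 * (s - (3 / 2)) ^ 12 * (2 - s) +
      3064996864 / 6496875 * (s - (3 / 2)) ^ 13 := by
    simp only [erfTaylor, Finset.sum_range_succ, Finset.sum_range_zero, Nat.factorial]
    push_cast
    ring
  rw [key]
  positivity

/-- Certified on each piece by nonnegative Bernstein coefficients. -/
theorem erfTaylor_mul_le {s : ℝ} (hs : 0 ≤ s) (hs2 : s ≤ 2) :
    (1 / 2 - 3989 / 10000 * erfTaylor 6 s) * (s ^ 2 + 2 * (2366 / 10000)) ≤ 2366 / 10000 := by
  rw [← sub_nonneg]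
  rcases le_total s (1 / 2) with hb | ha1
  · have hu := sub_nonneg.2 hs
    have hv := sub_nonneg.2 hb
    have key : 2366 / 10000 - (1 / 2 - 3989 / 10000 * erfTaylor 6 s) * (s ^ 2 + 2 * (2366 / 10000)) =
        s * (302015168 / 390625 * (1 / 2 - s) ^ 12 +
        3224182016 / 390625 * s * (1 / 2 - s) ^ 11 +
        47039931368 / 1171875 * s ^ 2 * (1 / 2 - s) ^ 10 +
        27547858384 / 234375 * s ^ 3 * (1 / 2 - s) ^ 9 +
        2703157598561 / 11718750 * s ^ 4 * (1 / 2 - s) ^ 8 +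
        1871755886084 / 5859375 * s ^ 5 * (1 / 2 - s) ^ 7 +
        9996342208813 / 31250000 * s ^ 6 * (1 / 2 - s) ^ 6 +
        10930740607189 / 46875000 * s ^ 7 * (1 / 2 - s) ^ 5 +
        4638443148585101 / 37800000000 * s ^ 8 * (1 / 2 - s) ^ 4 +
        2145740626371457 / 47250000000 * s ^ 9 * (1 / 2 - s) ^ 3 +
        186383533321358851 / 16632000000000 * s ^ 10 * (1 / 2 - s) ^ 2 +
        916723232542253 / 554400000000 * s ^ 11 * (1 / 2 - s) +
        114542925995693 / 1039500000000 * s ^ 12) := by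
      simp only [erfTaylor, Finset.sum_range_succ, Finset.sum_range_zero, Nat.factorial]
      push_cast
      ring
    rw [sub_zero] at hu
    rw [key]
    positivity
  rcases le_total s (3 / 4) with hb | ha2
  · have hu := sub_nonneg.2 ha1
    have hv := sub_nonneg.2 hb
    have key : 2366 / 10000 - (1 / 2 - 3989 / 10000 * erfTaylor 6 s) * (s ^ 2 + 2 * (2366 / 10000)) =
        s * (1832686815931088 / 4060546875 * (3 / 4 - s) ^ 12 +
        582954975715933 / 123046875 * (s - (1 / 2)) * (3 / 4 - s) ^ 11 +
        367443501767594653 / 16242187500 * (s - (1 / 2)) ^ 2 * (3 / 4 - s) ^ 10 +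
        263628122817027292 / 4060546875 * (s - (1 / 2)) ^ 3 * (3 / 4 - s) ^ 9 +
        1156377846139758811 / 9281250000 * (s - (1 / 2)) ^ 4 * (3 / 4 - s) ^ 8 +
        1821666055480819589 / 10828125000 * (s - (1 / 2)) ^ 5 * (3 / 4 - s) ^ 7 +
        337550345505253379 / 2062500000 * (s - (1 / 2)) ^ 6 * (3 / 4 - s) ^ 6 +
        832896038702152261 / 7218750000 * (s - (1 / 2)) ^ 7 * (3 / 4 - s) ^ 5 +
        3371964471854698609 / 57750000000 * (s - (1 / 2)) ^ 8 * (3 / 4 - s) ^ 4 +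
        2383755085454936933 / 115500000000 * (s - (1 / 2)) ^ 9 * (3 / 4 - s) ^ 3 +
        2229052745952162497 / 462000000000 * (s - (1 / 2)) ^ 10 * (3 / 4 - s) ^ 2 +
        3675502112664721 / 5500000000 * (s - (1 / 2)) ^ 11 * (3 / 4 - s) +
        25520374264886579 / 616000000000 * (s - (1 / 2)) ^ 12) := by
      simp only [erfTaylor, Finset.sum_range_succ, Finset.sum_range_zero, Nat.factorial]
      push_cast
      ring
    rw [key]
    positivity
  rcases le_total s 1 with hb | ha3
  · have hu := sub_nonneg.2 ha2
    have hv := sub_nonneg.2 hb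
    have key : 2366 / 10000 - (1 / 2 - 3989 / 10000 * erfTaylor 6 s) * (s ^ 2 + 2 * (2366 / 10000)) =
        s * (25520374264886579 / 616000000000 * (1 - s) ^ 12 +
        25104093217353643 / 77000000000 * (s - (3 / 4)) * (1 - s) ^ 11 +
        489758946195300731 / 462000000000 * (s - (3 / 4)) ^ 2 * (1 - s) ^ 10 +
        101206195603717801 / 57750000000 * (s - (3 / 4)) ^ 3 * (1 - s) ^ 9 +
        39137048414587121 / 28875000000 * (s - (3 / 4)) ^ 4 * (1 - s) ^ 8 +
        168730137505931 / 902343750 * (s - (3 / 4)) ^ 5 * (1 - s) ^ 7 +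
        37789610810153 / 128906250 * (s - (3 / 4)) ^ 6 * (1 - s) ^ 6 +
        608906555960452 / 270703125 * (s - (3 / 4)) ^ 7 * (1 - s) ^ 5 +
        15404722460291608 / 4060546875 * (s - (3 / 4)) ^ 8 * (1 - s) ^ 4 +
        13087663916528896 / 4060546875 * (s - (3 / 4)) ^ 9 * (1 - s) ^ 3 +
        1268286151479488 / 812109375 * (s - (3 / 4)) ^ 10 * (1 - s) ^ 2 +
        561408289203712 / 1353515625 * (s - (3 / 4)) ^ 11 * (1 - s) +
        38352306709504 / 812109375 * (s - (3 / 4)) ^ 12) := by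
      simp only [erfTaylor, Finset.sum_range_succ, Finset.sum_range_zero, Nat.factorial]
      push_cast
      ring
    rw [key]
    positivity
  have hu := sub_nonneg.2 ha3
  have hv := sub_nonneg.2 hs2
  have key : 2366 / 10000 - (1 / 2 - 3989 / 10000 * erfTaylor 6 s) * (s ^ 2 + 2 * (2366 / 10000)) =
      s * (37453424521 / 13305600000000 * (2 - s) ^ 12 +
      258723553733 / 3696000000000 * (s - 1) * (2 - s) ^ 11 +
      1320869185193 / 1900800000000 * (s - 1) ^ 2 * (2 - s) ^ 10 +
      59994999012611 / 16632000000000 * (s - 1) ^ 3 * (2 - s) ^ 9 +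
      378204768911441 / 33264000000000 * (s - 1) ^ 4 * (2 - s) ^ 8 +
      982527605029 / 41580000000 * (s - 1) ^ 5 * (2 - s) ^ 7 +
      20114012889769 / 594000000000 * (s - 1) ^ 6 * (2 - s) ^ 6 +
      35496341520247 / 1039500000000 * (s - 1) ^ 7 * (2 - s) ^ 5 +
      50416355255177 / 2079000000000 * (s - 1) ^ 8 * (2 - s) ^ 4 +
      110277389459 / 9281250000 * (s - 1) ^ 9 * (2 - s) ^ 3 +
      1981997321303 / 519750000000 * (s - 1) ^ 10 * (2 - s) ^ 2 +
      30944634557 / 43312500000 * (s - 1) ^ 11 * (2 - s) +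
      14960968907 / 259875000000 * (s - 1) ^ 12) := by
    simp only [erfTaylor, Finset.sum_range_succ, Finset.sum_range_zero, Nat.factorial]
    push_cast
    ring
  rw [key]
  positivity

theorem sq_mul_Phi_neg_le {s : ℝ} (hs : 0 < s) : s ^ 2 * Phi (-s) ≤ 1662 / 10000 := by
  rcases le_total s 2 with h | h
  · exact (mul_le_mul_of_nonneg_left (Phi_neg_le_erfTaylor hs) (by positivity)).trans
      (sq_mul_erfTaylor_le hs.le h)
  · obtain ⟨t, ht, rfl⟩ : ∃ t : ℝ, 0 ≤ t ∧ s = 2 + t := ⟨s - 2, by linarith, by ring⟩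
    set w := (2 + t) * (1 + (2 + t) ^ 2 / 2 + ((2 + t) ^ 2 / 2) ^ 2 / 2) with hw
    have hwpos : 0 < w := by positivity
    have h1 : Phi (-(2 + t)) ≤ 399 / 1000 / w := (le_div_iff₀ hwpos).2 (Phi_neg_mul_le hs)
    have h2 : (2 + t) ^ 2 * (399 / 1000 / w) ≤ 1662 / 10000 := by
      rw [← mul_div_assoc, div_le_iff₀ hwpos, ← sub_nonneg, hw]
      ring_nf
      positivity
    exact (mul_le_mul_of_nonneg_left h1 (by positivity)).trans h2

theorem Phi_neg_mul_add_le {s : ℝ} (hs : 0 < s) :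
    Phi (-s) * (s ^ 2 + 2 * (2366 / 10000)) ≤ 2366 / 10000 := by
  rcases le_total s 2 with h | h
  · exact (mul_le_mul_of_nonneg_right (Phi_neg_le_erfTaylor hs) (by positivity)).trans
      (erfTaylor_mul_le hs.le h)
  · obtain ⟨t, ht, rfl⟩ : ∃ t : ℝ, 0 ≤ t ∧ s = 2 + t := ⟨s - 2, by linarith, by ring⟩
    set w := (2 + t) * (1 + (2 + t) ^ 2 / 2 + ((2 + t) ^ 2 / 2) ^ 2 / 2) with hw
    have hwpos : 0 < w := by positivity
    have h1 : Phi (-(2 + t)) ≤ 399 / 1000 / w := (le_div_iff₀ hwpos).2 (Phi_neg_mul_le hs)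
    have h2 : 399 / 1000 / w * ((2 + t) ^ 2 + 2 * (2366 / 10000)) ≤ 2366 / 10000 := by
      rw [div_mul_eq_mul_div, div_le_iff₀ hwpos, ← sub_nonneg, hw]
      ring_nf
      positivity
    exact (mul_le_mul_of_nonneg_right h1 (by positivity)).trans h2

theorem sq_mul_Phi_neg_div_le {s : ℝ} (hs : 0 < s) :
    s ^ 2 * Phi (-s) / (1 - 2 * Phi (-s)) ≤ 2366 / 10000 := by
  rw [div_le_iff₀ (by linarith [Phi_neg_lt_half hs])]
  linarith [Phi_neg_mul_add_le hs]

theorem le_sq_mul_Phi_neg : 1655 / 10000 ≤ (119 / 100 : ℝ) ^ 2 * Phi (-(119 / 100)) := by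
  have h := erfTaylor_le_Phi_neg (s := 119 / 100) (by norm_num)
  norm_num [erfTaylor, Finset.sum_range_succ, Nat.factorial] at h ⊢
  linarith

theorem le_sq_mul_Phi_neg_div :
    2361 / 10000 ≤ (108 / 125 : ℝ) ^ 2 * Phi (-(108 / 125)) / (1 - 2 * Phi (-(108 / 125))) := by
  have h := erfTaylor_le_Phi_neg (s := 108 / 125) (by norm_num)
  rw [le_div_iff₀ (by linarith [Phi_neg_lt_half (s := 108 / 125) (by norm_num)])]
  norm_num [erfTaylor, Finset.sum_range_succ, Nat.factorial] at h ⊢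
  linarith

/-- with M1 = sup_{s>0} s^2 Phi(-s) and
M2 = sup_{s>0} s^2 Phi(-s)/(1 - 2 Phi(-s)), we have 1.42 < M2/M1 < 1.43:
the optimally scaled non-reversible tempering algorithm is about 42% more
efficient than the optimally scaled reversible one. -/
theorem forty_two_percent_speedup
    (M₁ M₂ : ℝ)
    (hM₁ : M₁ = sSup ((fun s : ℝ => s ^ 2 * Phi (-s)) '' Set.Ioi 0))
    (hM₂ : M₂ = sSup ((fun s : ℝ => s ^ 2 * Phi (-s) / (1 - 2 * Phi (-s))) '' Set.Ioi 0)) :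
    1.42 < M₂ / M₁ ∧ M₂ / M₁ < 1.43 := by
  have hub₁ : (1662 / 10000 : ℝ) ∈
      upperBounds ((fun s : ℝ => s ^ 2 * Phi (-s)) '' Set.Ioi 0) := by
    rintro _ ⟨s, hs, rfl⟩
    exact sq_mul_Phi_neg_le hs
  have hub₂ : (2366 / 10000 : ℝ) ∈
      upperBounds ((fun s : ℝ => s ^ 2 * Phi (-s) / (1 - 2 * Phi (-s))) '' Set.Ioi 0) := by
    rintro _ ⟨s, hs, rfl⟩
    exact sq_mul_Phi_neg_div_le hs
  have hl₁ : 1655 / 10000 ≤ M₁ := hM₁ ▸ le_sq_mul_Phi_neg.trans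
    (le_csSup ⟨_, hub₁⟩ ⟨119 / 100, by norm_num [mem_Ioi], rfl⟩)
  have hl₂ : 2361 / 10000 ≤ M₂ := hM₂ ▸ le_sq_mul_Phi_neg_div.trans
    (le_csSup ⟨_, hub₂⟩ ⟨108 / 125, by norm_num [mem_Ioi], rfl⟩)
  have hu₁ : M₁ ≤ 1662 / 10000 := hM₁ ▸ csSup_le (nonempty_Ioi.image _) hub₁
  have hu₂ : M₂ ≤ 2366 / 10000 := hM₂ ▸ csSup_le (nonempty_Ioi.image _) hub₂
  have hpos : 0 < M₁ := by linarith
  constructor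
  · rw [lt_div_iff₀ hpos]
    norm_num
    linarith
  · rw [div_lt_iff₀ hpos]
    norm_num
    linarith
end

section
/- Let A, B, C be nonnegative reals with A+B+C=1 and C>0, and let (X_n, Y_n) be the double-birth-death Markov chain started at (0,+). Let T₁ be the first time n ≥ 1 at which Y_n = + and the chain has previously visited the row {−}. Then E[X_{T₁}] = 0. -/
open MeasureTheory ProbabilityTheory

/-- The first time n ≥ 1 at which the chain is in the "+" row having previously
visited the "−" row. -/
noncomputable def T1 {Ω : Type*} (Y : ℕ → Ω → Bool) (ω : Ω) : ℕ :=
  sInf {n | 1 ≤ n ∧ Y n ω = true ∧ ∃ m < n, Y m ω = false}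

lemma dbdStep_nonneg {A B C : ℝ} (hA : 0 ≤ A) (hB : 0 ≤ B) (hC : 0 ≤ C) (x y : ℤ × Bool) :
    0 ≤ dbdStep A B C x y := by
  rcases x with ⟨i, _ | _⟩ <;> rcases y with ⟨j, _ | _⟩ <;> simp only [dbdStep] <;>
    split_ifs <;> first | assumption | exact le_rfl

/-- The law of the increment of `X` inside the "+" row, restricted to staying in that row. -/
noncomputable def rowIncrement (A B : ℝ) (d : ℤ) : ENNReal :=
  ENNReal.ofReal (if d = 1 then A else if d = -1 then B else 0)

/-- The `n`-fold convolution power of `rowIncrement A B`. -/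
noncomputable def rowWeight (A B : ℝ) : ℕ → ℤ → ENNReal
  | 0, d => if d = 0 then 1 else 0
  | n + 1, d => ∑' i, rowIncrement A B (d - i) * rowWeight A B n i

lemma ofReal_dbdStep_true_true (A B C : ℝ) (i j : ℤ) :
    ENNReal.ofReal (dbdStep A B C (i, true) (j, true)) = rowIncrement A B (j - i) := by
  have h1 : j = i + 1 ↔ j - i = 1 := by omega
  have h2 : j = i - 1 ↔ j - i = -1 := by omega
  simp only [dbdStep, rowIncrement, h1, h2]

lemma ofReal_dbdStep_false_false (A B C : ℝ) (i j : ℤ) :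
    ENNReal.ofReal (dbdStep A B C (i, false) (j, false)) = rowIncrement A B (i - j) := by
  have h1 : j = i - 1 ↔ i - j = 1 := by omega
  have h2 : j = i + 1 ↔ i - j = -1 := by omega
  simp only [dbdStep, rowIncrement, h1, h2]

namespace IsDBDChain

variable {Ω : Type*} [MeasurableSpace Ω] {μ : Measure Ω} {A B C : ℝ}
  {X : ℕ → Ω → ℤ} {Y : ℕ → Ω → Bool}

lemma measurable_pair (h : IsDBDChain μ A B C X Y) (n : ℕ) :
    Measurable fun ω => (X n ω, Y n ω) :=
  (h.1 n).prodMk (h.2.1 n)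

lemma measure_path [IsFiniteMeasure μ] (h : IsDBDChain μ A B C X Y) (n : ℕ) (s : ℕ → ℤ × Bool) :
    μ {ω | ∀ k ≤ n, (X k ω, Y k ω) = s k} =
      ENNReal.ofReal ((if s 0 = ((0 : ℤ), true) then (1 : ℝ) else 0) *
        ∏ k ∈ Finset.range n, dbdStep A B C (s k) (s (k + 1))) := by
  rw [← h.2.2 n s, ENNReal.ofReal_toReal (measure_ne_top _ _)]

lemma measure_path_succ [IsFiniteMeasure μ] (h : IsDBDChain μ A B C X Y)
    (hA : 0 ≤ A) (hB : 0 ≤ B) (hC : 0 ≤ C) (n : ℕ) (s : ℕ → ℤ × Bool) :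
    μ {ω | ∀ k ≤ n + 1, (X k ω, Y k ω) = s k} =
      ENNReal.ofReal (dbdStep A B C (s n) (s (n + 1))) *
        μ {ω | ∀ k ≤ n, (X k ω, Y k ω) = s k} := by
  rw [h.measure_path, h.measure_path, Finset.prod_range_succ, ← mul_assoc,
    ENNReal.ofReal_mul' (dbdStep_nonneg hA hB hC _ _), mul_comm]

/-- The Markov property, for events described by the path up to time `n`. -/
lemma measure_markov [IsFiniteMeasure μ] (h : IsDBDChain μ A B C X Y)
    (hA : 0 ≤ A) (hB : 0 ≤ B) (hC : 0 ≤ C) (n : ℕ) (S : Set (Fin (n + 1) → ℤ × Bool))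
    (x y : ℤ × Bool) :
    μ {ω | (fun k : Fin (n + 1) => (X k ω, Y k ω)) ∈ S ∧
        (X n ω, Y n ω) = x ∧ (X (n + 1) ω, Y (n + 1) ω) = y} =
      ENNReal.ofReal (dbdStep A B C x y) *
        μ {ω | (fun k : Fin (n + 1) => (X k ω, Y k ω)) ∈ S ∧ (X n ω, Y n ω) = x} := by
  set path : Ω → Fin (n + 1) → ℤ × Bool := fun ω k => (X k ω, Y k ω) with hpath_def
  have hpath : Measurable path := measurable_pi_lambda _ fun k => h.measurable_pair k
  have key : (μ.restrict {ω | (X n ω, Y n ω) = x ∧ (X (n + 1) ω, Y (n + 1) ω) = y}).map path =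
      ENNReal.ofReal (dbdStep A B C x y) • (μ.restrict {ω | (X n ω, Y n ω) = x}).map path := by
    refine Measure.ext_of_singleton fun t => ?_
    have ht := measurableSet_singleton t
    rw [Measure.smul_apply, Measure.map_apply hpath ht, Measure.map_apply hpath ht,
      Measure.restrict_apply (hpath ht), Measure.restrict_apply (hpath ht), smul_eq_mul]
    by_cases hx : t (Fin.last n) = x
    · let s : ℕ → ℤ × Bool := fun k => if hk : k < n + 1 then t ⟨k, hk⟩ else y
      have hsn : s n = x := (dif_pos n.lt_succ_self).trans hx
      have hsn' : s (n + 1) = y := by simp [s]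
      have hiff : ∀ ω, path ω = t ↔ ∀ k ≤ n, (X k ω, Y k ω) = s k := by
        intro ω
        rw [funext_iff, Fin.forall_iff]
        refine forall_congr' fun k => ⟨fun H hk => ?_, fun H hk => ?_⟩
        · have hk' : k < n + 1 := by omega
          exact (H hk').trans (show s k = _ from dif_pos hk').symm
        · exact (H (by omega)).trans (dif_pos hk)
      have := h.measure_path_succ hA hB hC n s
      rw [hsn, hsn'] at this
      convert this using 2
      · ext ω
        simp only [Set.mem_inter_iff, Set.mem_preimage, Set.mem_singleton_iff, Set.mem_ofPred_eq,
          hiff]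
        refine ⟨fun H k hk => ?_, fun H => ⟨fun k hk => H k (by omega), ?_, ?_⟩⟩
        · rcases Nat.lt_or_ge n k with hk' | hk'
          · obtain rfl : k = n + 1 := by omega
            rw [hsn', H.2.2]
          · exact H.1 k hk'
        · rw [← hsn]; exact H n (by omega)
        · rw [← hsn']; exact H _ le_rfl
      · congr 1
        ext ω
        simp only [Set.mem_inter_iff, Set.mem_preimage, Set.mem_singleton_iff, Set.mem_ofPred_eq,
          hiff, and_iff_left_iff_imp]
        intro H
        rw [← hsn]; exact H n le_rfl
    · have hne : ∀ ω, path ω = t → (X n ω, Y n ω) ≠ x := by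
        rintro ω rfl hω
        exact hx hω
      rw [Set.eq_empty_of_forall_notMem (s := path ⁻¹' {t} ∩ {ω | (X n ω, Y n ω) = x})
          fun ω hω => hne ω hω.1 hω.2,
        Set.eq_empty_of_forall_notMem (s := path ⁻¹' {t} ∩
          {ω | (X n ω, Y n ω) = x ∧ (X (n + 1) ω, Y (n + 1) ω) = y})
          fun ω hω => hne ω hω.1 hω.2.1]
      simp
  have hS : MeasurableSet S := S.to_countable.measurableSet
  have := congrArg (fun ν => ν S) key
  simp only [Measure.smul_apply, Measure.map_apply hpath hS,
    Measure.restrict_apply (hpath hS), smul_eq_mul] at this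
  exact this

/-- Forward equation for the position jointly with a prescribed sequence of rows. -/
lemma measure_row_succ [IsFiniteMeasure μ] (h : IsDBDChain μ A B C X Y)
    (hA : 0 ≤ A) (hB : 0 ≤ B) (hC : 0 ≤ C) (y : ℕ → Bool) (n : ℕ) (j : ℤ) :
    μ {ω | (∀ k ≤ n + 1, Y k ω = y k) ∧ X (n + 1) ω = j} =
      ∑' i, ENNReal.ofReal (dbdStep A B C (i, y n) (j, y (n + 1))) *
        μ {ω | (∀ k ≤ n, Y k ω = y k) ∧ X n ω = i} := by
  have hrow : ∀ m, MeasurableSet {ω | ∀ k ≤ m, Y k ω = y k} := fun m => by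
    have : {ω | ∀ k ≤ m, Y k ω = y k} = ⋂ k, ⋂ (_ : k ≤ m), Y k ⁻¹' {y k} := by
      ext ω; simp
    rw [this]
    exact .iInter fun k => .iInter fun _ => h.2.1 k (measurableSet_singleton _)
  have hunion : {ω | (∀ k ≤ n + 1, Y k ω = y k) ∧ X (n + 1) ω = j} =
      ⋃ i, {ω | (∀ k ≤ n + 1, Y k ω = y k) ∧ X (n + 1) ω = j} ∩ X n ⁻¹' {i} := by
    ext ω; simp
  rw [hunion, measure_iUnion]
  · refine tsum_congr fun i => ?_
    have := h.measure_markov hA hB hC n {t | ∀ k, (t k).2 = y k} (i, y n) (j, y (n + 1))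
    convert this using 2
    · ext ω
      simp only [Set.mem_inter_iff, Set.mem_ofPred_eq, Set.mem_preimage, Set.mem_singleton_iff,
        Prod.mk.injEq, Fin.forall_iff]
      refine ⟨fun H => ⟨fun k hk => H.1.1 k (by omega), ⟨H.2, H.1.1 n (by omega)⟩, H.1.2,
        H.1.1 _ le_rfl⟩, fun H => ⟨⟨fun k hk => ?_, H.2.2.1⟩, H.2.1.1⟩⟩
      rcases Nat.lt_or_ge n k with hk' | hk'
      · obtain rfl : k = n + 1 := by omega
        exact H.2.2.2
      · exact H.1 k (by omega)
    · congr 1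
      ext ω
      simp only [Set.mem_ofPred_eq, Prod.mk.injEq, Fin.forall_iff]
      exact ⟨fun H => ⟨fun k hk => H.1 k (by omega), H.2, H.1 n le_rfl⟩,
        fun H => ⟨fun k hk => H.1 k (by omega), H.2.1⟩⟩
  · intro i i' hii
    exact ((Set.disjoint_singleton.2 hii).preimage (X n)).mono Set.inter_subset_right
      Set.inter_subset_right
  · intro i
    exact ((hrow (n + 1)).inter (h.1 (n + 1) (measurableSet_singleton j))).inter
      (h.1 n (measurableSet_singleton i))

/-- The rows visited by a trajectory making `p` steps in the "+" row, then `q` steps in the "−" row,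
and then returning to the "+" row for good. -/
def excursionRows (p q k : ℕ) : Bool := decide (k ≤ p ∨ p + q + 2 ≤ k)

lemma measure_excursion_plus [IsFiniteMeasure μ] (h : IsDBDChain μ A B C X Y)
    (hA : 0 ≤ A) (hB : 0 ≤ B) (hC : 0 ≤ C) (p q n : ℕ) (hn : n ≤ p) (a : ℤ) :
    μ {ω | (∀ k ≤ n, Y k ω = excursionRows p q k) ∧ X n ω = a} = rowWeight A B n a := by
  induction n generalizing a with
  | zero =>
    have := h.measure_path 0 fun _ => (a, true)
    simp only [nonpos_iff_eq_zero, forall_eq, Prod.mk.injEq, and_true, Finset.range_zero,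
      Finset.prod_empty, mul_one] at this
    simp only [nonpos_iff_eq_zero, forall_eq, excursionRows, zero_le, true_or, decide_true,
      rowWeight]
    simp only [and_comm (a := Y 0 _ = true), this]
    split_ifs <;> simp
  | succ n ih =>
    have h1 : excursionRows p q n = true := by simp [excursionRows]; omega
    have h2 : excursionRows p q (n + 1) = true := by simp [excursionRows]; omega
    rw [h.measure_row_succ hA hB hC, rowWeight]
    refine tsum_congr fun i => ?_
    rw [ih (by omega), h1, h2, ofReal_dbdStep_true_true]

lemma measure_excursion_minus [IsFiniteMeasure μ] (h : IsDBDChain μ A B C X Y)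
    (hA : 0 ≤ A) (hB : 0 ≤ B) (hC : 0 ≤ C) (p q n : ℕ) (hn : n ≤ q) (b : ℤ) :
    μ {ω | (∀ k ≤ p + 1 + n, Y k ω = excursionRows p q k) ∧ X (p + 1 + n) ω = b} =
      ENNReal.ofReal C * ∑' a, rowWeight A B p a * rowWeight A B n (a - b) := by
  induction n generalizing b with
  | zero =>
    have h1 : excursionRows p q p = true := by simp [excursionRows]
    have h2 : excursionRows p q (p + 1) = false := by simp [excursionRows]
    rw [add_zero, h.measure_row_succ hA hB hC, h1, h2,
      tsum_eq_single b fun i hi => by simp [dbdStep, hi.symm],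
      tsum_eq_single b fun i hi => by simp [rowWeight, sub_eq_zero, hi],
      h.measure_excursion_plus hA hB hC p q p le_rfl]
    simp [dbdStep, rowWeight]
  | succ n ih =>
    have h1 : excursionRows p q (p + 1 + n) = false := by simp [excursionRows]; omega
    have h2 : excursionRows p q (p + 1 + n + 1) = false := by simp [excursionRows]; omega
    rw [← add_assoc, h.measure_row_succ hA hB hC, h1, h2]
    simp_rw [ih (by omega), ofReal_dbdStep_false_false, mul_left_comm _ (ENNReal.ofReal C),
      ENNReal.tsum_mul_left, ← ENNReal.tsum_mul_left (a := rowIncrement _ _ _)]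
    rw [ENNReal.tsum_comm]
    congr 1
    refine tsum_congr fun a => ?_
    rw [rowWeight, ← ENNReal.tsum_mul_left, ← (Equiv.subLeft a).tsum_eq]
    refine tsum_congr fun i => ?_
    simp only [Equiv.subLeft_apply]
    rw [mul_left_comm, show a - i - b = a - b - i by ring, sub_sub_cancel]

lemma measure_excursion [IsFiniteMeasure μ] (h : IsDBDChain μ A B C X Y)
    (hA : 0 ≤ A) (hB : 0 ≤ B) (hC : 0 ≤ C) (p q : ℕ) (b : ℤ) :
    μ {ω | (∀ k ≤ p + q + 2, Y k ω = excursionRows p q k) ∧ X (p + q + 2) ω = b} =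
      ENNReal.ofReal C *
        (ENNReal.ofReal C * ∑' a, rowWeight A B p a * rowWeight A B q (a - b)) := by
  have h1 : excursionRows p q (p + 1 + q) = false := by simp [excursionRows]; omega
  have h2 : excursionRows p q (p + 1 + q + 1) = true := by
    rw [excursionRows, decide_eq_true_eq]; omega
  rw [show p + q + 2 = p + 1 + q + 1 by ring, h.measure_row_succ hA hB hC, h1, h2,
    tsum_eq_single b fun i hi => by simp [dbdStep, hi.symm],
    h.measure_excursion_minus hA hB hC p q q le_rfl]
  simp [dbdStep]

/-- Exchanging the two halves of an excursion reflects its displacement. -/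
lemma measure_excursion_swap [IsFiniteMeasure μ] (h : IsDBDChain μ A B C X Y)
    (hA : 0 ≤ A) (hB : 0 ≤ B) (hC : 0 ≤ C) (p q : ℕ) (b : ℤ) :
    μ {ω | (∀ k ≤ q + p + 2, Y k ω = excursionRows q p k) ∧ X (q + p + 2) ω = -b} =
      μ {ω | (∀ k ≤ p + q + 2, Y k ω = excursionRows p q k) ∧ X (p + q + 2) ω = b} := by
  rw [h.measure_excursion hA hB hC, h.measure_excursion hA hB hC, ← (Equiv.subRight b).tsum_eq]
  simp [mul_comm]

lemma ae_start [IsProbabilityMeasure μ] (h : IsDBDChain μ A B C X Y) :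
    ∀ᵐ ω ∂μ, X 0 ω = 0 ∧ Y 0 ω = true := by
  have h1 := h.measure_path 0 fun _ => ((0 : ℤ), true)
  simp only [nonpos_iff_eq_zero, forall_eq, if_true, Finset.range_zero, Finset.prod_empty, mul_one,
    ENNReal.ofReal_one] at h1
  have hm : MeasurableSet {ω | (X 0 ω, Y 0 ω) = ((0 : ℤ), true)} :=
    h.measurable_pair 0 (measurableSet_singleton _)
  filter_upwards [(mem_ae_iff_prob_eq_one hm).2 h1] with ω hω
  simpa using hω

end IsDBDChain

lemma T1_eq_of_excursion {Ω : Type*} {Y : ℕ → Ω → Bool} {ω : Ω} {p q : ℕ}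
    (h : ∀ k ≤ p + q + 2, Y k ω = IsDBDChain.excursionRows p q k) : T1 Y ω = p + q + 2 := by
  refine le_antisymm (Nat.sInf_le ⟨by omega, ?_, p + 1, by omega, ?_⟩)
    (le_csInf ⟨p + q + 2, by omega, ?_, p + 1, by omega, ?_⟩ ?_)
  · simp [h, IsDBDChain.excursionRows]
  · simp [h (p + 1) (by omega), IsDBDChain.excursionRows]
  · simp [h, IsDBDChain.excursionRows]
  · simp [h (p + 1) (by omega), IsDBDChain.excursionRows]
  · rintro n ⟨-, hn, m, hmn, hm⟩
    by_contra! hlt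
    rw [h n (by omega)] at hn
    rw [h m (by omega)] at hm
    simp only [IsDBDChain.excursionRows, decide_eq_true_eq, decide_eq_false_iff_not] at hn hm
    omega

lemma exists_excursion_of_T1_ne_zero {Ω : Type*} {Y : ℕ → Ω → Bool} {ω : Ω}
    (h0 : Y 0 ω = true) (hT : T1 Y ω ≠ 0) :
    ∃ p q, ∀ k ≤ p + q + 2, Y k ω = IsDBDChain.excursionRows p q k := by
  have hmem : T1 Y ω ∈ {n | 1 ≤ n ∧ Y n ω = true ∧ ∃ m < n, Y m ω = false} :=
    Nat.sInf_mem (Nat.nonempty_of_pos_sInf (Nat.pos_of_ne_zero hT))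
  obtain ⟨-, hTtrue, hex⟩ := hmem
  have hmin : ∀ n, 1 ≤ n → n < T1 Y ω → ∀ m < n, Y m ω = false → Y n ω = false := by
    intro n hn hnT m hm hYm
    have := Nat.notMem_of_lt_sInf hnT
    by_contra hne
    exact this ⟨hn, by simpa using hne, m, hm, hYm⟩
  have hex' : ∃ m, Y m ω = false := hex.imp fun _ => And.right
  obtain ⟨m, hmT, hm⟩ := hex
  have hfle : Nat.find hex' ≤ m := Nat.find_min' hex' hm
  have hf := Nat.find_spec hex'
  have hflt : ∀ k < Nat.find hex', Y k ω = true := fun k hk => by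
    simpa using Nat.find_min hex' hk
  generalize Nat.find hex' = f at *
  have hf0 : f ≠ 0 := by
    rintro rfl
    simp [h0] at hf
  refine ⟨f - 1, T1 Y ω - f - 1, fun k hk => ?_⟩
  rcases lt_trichotomy k f with hkf | rfl | hkf
  · rw [hflt k hkf, eq_comm, IsDBDChain.excursionRows, decide_eq_true_eq]
    omega
  · rw [hf, eq_comm, IsDBDChain.excursionRows, decide_eq_false_iff_not]
    omega
  · rcases (show k ≤ T1 Y ω by omega).eq_or_lt with rfl | hkT
    · rw [hTtrue, eq_comm, IsDBDChain.excursionRows, decide_eq_true_eq]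
      omega
    · rw [hmin k (by omega) hkT f hkf hf, eq_comm, IsDBDChain.excursionRows,
        decide_eq_false_iff_not]
      omega

namespace IsDBDChain

variable {Ω : Type*} [MeasurableSpace Ω] {μ : Measure Ω} {A B C : ℝ}
  {X : ℕ → Ω → ℤ} {Y : ℕ → Ω → Bool}

lemma measure_regeneration_displacement [IsProbabilityMeasure μ] (h : IsDBDChain μ A B C X Y)
    {b : ℤ} (hb : b ≠ 0) :
    μ {ω | X (T1 Y ω) ω = b} = ∑' r : ℕ × ℕ, μ {ω | (∀ k ≤ r.1 + r.2 + 2,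
      Y k ω = excursionRows r.1 r.2 k) ∧ X (r.1 + r.2 + 2) ω = b} := by
  rw [← measure_iUnion]
  · refine measure_congr ?_
    filter_upwards [h.ae_start] with ω hω
    refine propext ⟨fun H => ?_, fun H => ?_⟩
    · change X (T1 Y ω) ω = b at H
      have hT : T1 Y ω ≠ 0 := fun hT => hb (by rw [← H, hT, hω.1])
      obtain ⟨p, q, hpq⟩ := exists_excursion_of_T1_ne_zero hω.2 hT
      refine Set.mem_iUnion.2 ⟨(p, q), hpq, ?_⟩
      rw [← H, T1_eq_of_excursion hpq]
    · obtain ⟨⟨p, q⟩, hpq, hX⟩ := Set.mem_iUnion.1 H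
      change X (T1 Y ω) ω = b
      rw [T1_eq_of_excursion hpq, hX]
  · rintro ⟨p, q⟩ ⟨p', q'⟩ hne
    refine Set.disjoint_left.2 fun ω ⟨H, _⟩ ⟨H', _⟩ => hne ?_
    have hsum : p + q + 2 = p' + q' + 2 := by
      rw [← T1_eq_of_excursion H, ← T1_eq_of_excursion H']
    have hp : p = p' := by
      rcases lt_trichotomy p p' with hlt | heq | hlt
      · have := (H (p + 1) (by omega)).symm.trans (H' (p + 1) (by omega))
        simp only [excursionRows, decide_eq_decide] at this
        omega
      · exact heq
      · have := (H (p' + 1) (by omega)).symm.trans (H' (p' + 1) (by omega))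
        simp only [excursionRows, decide_eq_decide] at this
        omega
    exact Prod.ext hp (by dsimp only; omega)
  · rintro ⟨p, q⟩
    have : {ω | (∀ k ≤ p + q + 2, Y k ω = excursionRows p q k) ∧ X (p + q + 2) ω = b} =
        (⋂ k, ⋂ (_ : k ≤ p + q + 2), Y k ⁻¹' {excursionRows p q k}) ∩ X (p + q + 2) ⁻¹' {b} := by
      ext ω; simp
    rw [this]
    exact (MeasurableSet.iInter fun k => .iInter fun _ => h.2.1 k (measurableSet_singleton _)).inter
      (h.1 _ (measurableSet_singleton b))

/-- The law of the displacement at the regeneration time is symmetric. -/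
lemma measure_regeneration_displacement_neg [IsProbabilityMeasure μ]
    (h : IsDBDChain μ A B C X Y) (hA : 0 ≤ A) (hB : 0 ≤ B) (hC : 0 ≤ C) (b : ℤ) :
    μ {ω | X (T1 Y ω) ω = -b} = μ {ω | X (T1 Y ω) ω = b} := by
  rcases eq_or_ne b 0 with rfl | hb
  · rw [neg_zero]
  · rw [h.measure_regeneration_displacement hb,
      h.measure_regeneration_displacement (neg_ne_zero.2 hb), ← (Equiv.prodComm ℕ ℕ).tsum_eq]
    exact tsum_congr fun r => h.measure_excursion_swap hA hB hC r.1 r.2 b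

end IsDBDChain

/-- E[X_{T₁}] = 0. -/
theorem expectation_of_regeneration_displacement
    (A B C : ℝ) (hA : 0 ≤ A) (hB : 0 ≤ B) (hC : 0 < C) (hsum : A + B + C = 1)
    {Ω : Type*} [MeasurableSpace Ω] (μ : Measure Ω) [IsProbabilityMeasure μ]
    (X : ℕ → Ω → ℤ) (Y : ℕ → Ω → Bool)
    (hchain : IsDBDChain μ A B C X Y) :
    ∫ ω, ((X (T1 Y ω) ω : ℤ) : ℝ) ∂μ = 0 := by
  by_cases hintegrable : Integrable (fun ω => ((X (T1 Y ω) ω : ℤ) : ℝ)) μ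
  · have hmeas : AEMeasurable (fun ω => X (T1 Y ω) ω) μ := by
      simpa [Function.comp_def] using Int.measurable_floor.comp_aemeasurable hintegrable.aemeasurable
    have hmeas' : AEMeasurable (fun ω => -X (T1 Y ω) ω) μ := hmeas.neg
    have hident : IdentDistrib (fun ω => X (T1 Y ω) ω) (fun ω => -X (T1 Y ω) ω) μ μ := by
      refine ⟨hmeas, hmeas', Measure.ext_of_singleton fun b => ?_⟩
      rw [Measure.map_apply_of_aemeasurable hmeas (measurableSet_singleton b),
        Measure.map_apply_of_aemeasurable hmeas' (measurableSet_singleton b)]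
      simp only [Set.preimage, Set.mem_singleton_iff, neg_eq_iff_eq_neg]
      exact (hchain.measure_regeneration_displacement_neg hA hB hC.le b).symm
    have := (hident.comp (measurable_from_top (f := fun n : ℤ => (n : ℝ)))).integral_eq
    simp only [Function.comp_def, Int.cast_neg, integral_neg] at this
    linarith
  · exact integral_undef hintegrable
end
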